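/- arXiv:1710.00293 — 2 statements merged into one kernel-verified Lean document; each statement's English description precedes it below -/
import Mathlib

section
/- Let 𝔻^n = {x ∈ ℝ^n : ‖x‖ ≤ 1}. For all integers n ≥ 2 and k ≥ 2, the topological complexity of the configuration space F(𝔻^n,k) equals 2k−1 if n is odd, and equals 2k−2 if n is even. -/
open scoped Topology

/-- Ordered configuration space of `k` points in `X`: tuples of pairwise
distinct points, i.e. injective functions `Fin k → X`, topologized as a
subspace of the product `X^k`. -/
abbrev Conf (X : Type*) [TopologicalSpace X] (k : ℕ) : Type _ :=
  {f : Fin k → X // Function.Injective f}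

/-- `X × X` admits a cover by `m` open sets over each of which the endpoints
fibration admits a continuous section (a continuous motion planning rule). -/
def TCCover (X : Type*) [TopologicalSpace X] (m : ℕ) : Prop :=
  ∃ U : Fin m → Set (X × X),
    (∀ i, IsOpen (U i)) ∧ (⋃ i, U i) = Set.univ ∧
    ∀ i, ∃ s : C(↥(U i), C(unitInterval, X)),
      ∀ p : ↥(U i), (s p) 0 = (p : X × X).1 ∧ (s p) 1 = (p : X × X).2

/-- Farber's topological complexity of a space, valued in `ℕ∞` (it is `⊤ = ∞`
if no finite motion-planning cover exists). -/
noncomputable def TopologicalComplexity (X : Type*) [TopologicalSpace X] : ℕ∞ :=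
  sInf {m : ℕ∞ | ∃ c : ℕ, (c : ℕ∞) = m ∧ TCCover X c}

namespace ListCochain

variable {V W : Type*}

/-- The coboundary of a cochain, where a cochain is an integer function of finite sequences. -/
def cobdry : (List V → ℤ) → List V → ℤ
  | _, [] => 0
  | c, x :: l => c l - cobdry (fun l' => c (x :: l')) l

/-- The cup product of a `p`-cochain with another cochain. -/
def cup (p : ℕ) (a b : List V → ℤ) (l : List V) : ℤ :=
  a (l.take (p + 1)) * b (l.drop p)

/-- The iterated cup product of a list of `d`-cochains. -/
def cups (d : ℕ) : List (List V → ℤ) → List V → ℤ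
  | [] => fun _ => 1
  | a :: as => cup d a (cups d as)

/-- The prism operator between two maps of vertices. -/
def prism (f g : V → W) : (List W → ℤ) → List V → ℤ
  | _, [] => 0
  | c, x :: l => c (f x :: g x :: l.map g) - prism f g (fun l' => c (f x :: l')) l

lemma cobdry_sub (a b : List V → ℤ) (l : List V) :
    cobdry (fun l => a l - b l) l = cobdry a l - cobdry b l := by
  induction l generalizing a b with
  | nil => simp [cobdry]
  | cons x l ih => simp only [cobdry, ih]; ring

lemma cobdry_add (a b : List V → ℤ) (l : List V) :
    cobdry (fun l => a l + b l) l = cobdry a l + cobdry b l := by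
  induction l generalizing a b with
  | nil => simp [cobdry]
  | cons x l ih => simp only [cobdry, ih]; ring

lemma cobdry_const_mul (r : ℤ) (a : List V → ℤ) (l : List V) :
    cobdry (fun l => r * a l) l = r * cobdry a l := by
  induction l generalizing a with
  | nil => simp [cobdry]
  | cons x l ih => simp only [cobdry, ih]; ring

lemma cobdry_sum {ι : Type*} (s : Finset ι) (a : ι → List V → ℤ) (l : List V) :
    cobdry (fun l => ∑ i ∈ s, a i l) l = ∑ i ∈ s, cobdry (a i) l := by
  induction l generalizing a with
  | nil => simp [cobdry]
  | cons x l ih => simp only [cobdry, ih, Finset.sum_sub_distrib]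

lemma cobdry_map (f : V → W) (c : List W → ℤ) (l : List V) :
    cobdry (fun l => c (l.map f)) l = cobdry c (l.map f) := by
  induction l generalizing c with
  | nil => simp [cobdry]
  | cons x l ih =>
    simp only [cobdry, List.map_cons]
    rw [← ih]

lemma cobdry_cobdry (c : List V → ℤ) (l : List V) : cobdry (cobdry c) l = 0 := by
  induction l generalizing c with
  | nil => simp [cobdry]
  | cons x l ih =>
    simp only [cobdry, cobdry_sub, ih]
    ring

/-- The coboundary only depends on the values of the cochain on sublists one entry shorter. -/
lemma cobdry_congr {a b : List V → ℤ} {l : List V}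
    (h : ∀ l', l'.Sublist l → l'.length + 1 = l.length → a l' = b l') :
    cobdry a l = cobdry b l := by
  induction l generalizing a b with
  | nil => simp [cobdry]
  | cons x l ih =>
    simp only [cobdry]
    rw [h l (List.sublist_cons_self x l) (by simp),
      ih fun l' hl' hlen => h _ (hl'.cons_cons x) (by simp [← hlen])]

lemma cobdry_ofFn {m : ℕ} (c : List V → ℤ) (f : Fin (m + 1) → V) :
    cobdry c (List.ofFn f) =
      ∑ i : Fin (m + 1), (-1) ^ (i : ℕ) * c (List.ofFn (f ∘ i.succAbove)) := by
  induction m generalizing c with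
  | zero => simp [cobdry]
  | succ m ih =>
    rw [List.ofFn_succ, cobdry, ih]
    conv_rhs => rw [Fin.sum_univ_succ]
    simp only [Fin.val_zero, pow_zero, one_mul, Fin.val_succ, pow_succ]
    rw [sub_eq_add_neg, ← Finset.sum_neg_distrib]
    congr 1
    refine Finset.sum_congr rfl fun i _ => ?_
    have : List.ofFn (f ∘ i.succ.succAbove)
        = f 0 :: List.ofFn ((fun i : Fin (m + 1) => f i.succ) ∘ i.succAbove) := by
      rw [List.ofFn_succ]
      simp [Function.comp_def]
    rw [this]; ring

lemma cup_succ_cons (p : ℕ) (a b : List V → ℤ) (x : V) (l : List V) :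
    cup (p + 1) a b (x :: l) = cup p (fun l' => a (x :: l')) b l := by
  simp [cup]

lemma cobdry_cup (p : ℕ) (a b : List V → ℤ) (l : List V) (hl : p + 2 ≤ l.length) :
    cobdry (cup p a b) l = cup (p + 1) (cobdry a) b l + (-1) ^ p * cup p a (cobdry b) l := by
  induction p generalizing a l with
  | zero =>
    match l, hl with
    | x :: y :: l, _ =>
      have h : (fun l' => cup 0 a b (x :: l')) = fun l' => a [x] * b (x :: l') := by
        funext l'; simp [cup]
      rw [cobdry, h, cobdry_const_mul]
      simp [cup, cobdry]
      ring
  | succ p ih =>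
    match l, hl with
    | x :: l, hl =>
      have h : (fun l' => cup (p + 1) a b (x :: l')) = cup p (fun l' => a (x :: l')) b := by
        funext l'; exact cup_succ_cons ..
      rw [cobdry, h, ih _ _ (by simpa using hl), cup_succ_cons, cup_succ_cons]
      simp only [cup, cobdry]
      ring

lemma prism_sub (f g : V → W) (a b : List W → ℤ) (l : List V) :
    prism f g (fun l => a l - b l) l = prism f g a l - prism f g b l := by
  induction l generalizing a b with
  | nil => simp [prism]
  | cons x l ih => simp only [prism, ih]; ring

lemma cobdry_prism (f g : V → W) (c : List W → ℤ) (l : List V) :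
    cobdry (prism f g c) l + prism f g (cobdry c) l = c (l.map g) - c (l.map f) := by
  induction l generalizing c with
  | nil => simp [prism, cobdry]
  | cons x l ih =>
    have h := ih fun l' => c (f x :: l')
    have h' := cobdry_map g (fun l' => c (f x :: g x :: l')) l
    simp only [prism, cobdry, cobdry_sub, prism_sub, List.map_cons] at h h' ⊢
    linarith

lemma prism_eq_zero {f g : V → W} {c : List W → ℤ} {l : List V} {S : Set W}
    (hc : ∀ l' : List W, l'.length = l.length + 1 → (∀ y ∈ l', y ∈ S) → c l' = 0)
    (hf : ∀ x ∈ l, f x ∈ S) (hg : ∀ x ∈ l, g x ∈ S) : prism f g c l = 0 := by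
  induction l generalizing c with
  | nil => simp [prism]
  | cons x l ih =>
    simp only [List.mem_cons, forall_eq_or_imp] at hf hg
    rw [prism, hc _ (by simp) (by simpa using ⟨hf.1, hg.1, hg.2⟩), ih _ hf.2 hg.2, sub_zero]
    intro l' hl' h
    exact hc _ (by simp [hl']) (by simpa using ⟨hf.1, h⟩)

/-- Iterated cup products of cochains that are cocycles on a class of lists closed under sublists
are cocycles on that class. -/
lemma cobdry_cups_eq_zero {S : List V → Prop} (hS : ∀ l l', l'.Sublist l → S l → S l') {d : ℕ}
    (as : List (List V → ℤ))
    (has : ∀ a ∈ as, ∀ l, S l → l.length = d + 2 → cobdry a l = 0)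
    (l : List V) (hl : S l) (hlen : l.length = as.length * d + 2) :
    cobdry (cups d as) l = 0 := by
  induction as generalizing l with
  | nil =>
    obtain ⟨x, y, rfl⟩ := List.length_eq_two.1 (by simpa using hlen)
    simp [cobdry, cups]
  | cons a as ih =>
    simp only [List.length_cons, add_mul, one_mul] at hlen
    rw [cups, cobdry_cup _ _ _ _ (by omega), cup, cup,
      has a (by simp) _ (hS _ _ (List.take_sublist _ _) hl) (by simp; omega),
      ih (fun b hb => has b (by simp [hb])) _ (hS _ _ (List.drop_sublist _ _) hl)
        (by simp; omega)]
    simp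

/-- Changing cocycles by coboundaries changes iterated cup products by a coboundary. -/
lemma exists_cups_sub_eq_cobdry {S : List V → Prop}
    (hS : ∀ l l', l'.Sublist l → S l → S l') {p : ℕ} (as : List ((List V → ℤ) × (List V → ℤ)))
    (has : ∀ a ∈ as, ∀ l, S l → l.length = p + 1 + 2 → cobdry a.1 l = 0) :
    ∃ c : List V → ℤ, (as = [] → c = fun _ => 0) ∧ ∀ l, S l → l.length = as.length * (p + 1) + 1 →
      cups (p + 1) (as.map fun a l => a.1 l - cobdry a.2 l) l
        = cups (p + 1) (as.map Prod.fst) l - cobdry c l := by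
  induction as with
  | nil => exact ⟨fun _ => 0, fun _ => rfl, fun l _ hlen => by
      obtain ⟨x, rfl⟩ := List.length_eq_one_iff.1 (by simpa using hlen)
      simp [cups, cobdry]⟩
  | cons a as ih =>
    obtain ⟨c, hc0, hc⟩ := ih fun b hb => has b (by simp [hb])
    set A := cups (p + 1) (as.map fun a l => a.1 l - cobdry a.2 l) with hA
    have hAc : ∀ l, S l → l.length = as.length * (p + 1) + 2 → cobdry A l = 0 := by
      intro l hl hlen
      refine cobdry_cups_eq_zero hS _ ?_ l hl (by simpa using hlen)
      intro b hb l hl hlen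
      obtain ⟨b, hb', rfl⟩ := List.mem_map.1 hb
      rw [cobdry_sub, cobdry_cobdry, has b (List.mem_cons_of_mem _ hb') l hl hlen, sub_zero]
    refine ⟨fun l => cup p a.2 A l + (-1) ^ (p + 1) * cup (p + 1) a.1 c l, by simp,
      fun l hl hlen => ?_⟩
    simp only [List.length_cons, add_mul, one_mul] at hlen
    have h1 := hc (l.drop (p + 1)) (hS _ _ (List.drop_sublist _ _) hl) (by simp; omega)
    have h2 : cup p a.2 (cobdry A) l = 0 := by
      rw [cup, hAc _ (hS _ _ (List.drop_sublist _ _) hl) (by simp; omega), mul_zero]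
    have h3 : cobdry (cup p a.2 A) l = cup (p + 1) (cobdry a.2) A l := by
      rw [cobdry_cup _ _ _ _ (by omega), h2]; ring
    have h4 : (-1) ^ (p + 1) * cobdry (cup (p + 1) a.1 c) l = cup (p + 1) a.1 (cobdry c) l := by
      rcases Nat.eq_zero_or_pos as.length with h0 | h0
      · rw [hc0 (List.length_eq_zero_iff.1 h0)]
        have h : cup (p + 1) a.1 (fun _ => 0) = fun l => 0 * a.1 l := by funext; simp [cup]
        rw [h, cobdry_const_mul]
        have h' := cobdry_const_mul 0 (fun _ : List V => (0 : ℤ)) (l.drop (p + 1))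
        simp only [zero_mul] at h'
        simp [cup, h']
      have h6 := Nat.le_mul_of_pos_left (p + 1) h0
      have h5 : cup (p + 1 + 1) (cobdry a.1) c l = 0 := by
        rw [cup, has a (by simp) _ (hS _ _ (List.take_sublist _ _) hl)
          (by rw [List.length_take]; omega), zero_mul]
      rw [cobdry_cup _ _ _ _ (by omega), h5]
      rw [zero_add, ← mul_assoc, ← mul_pow]
      simp
    rw [cobdry_add, cobdry_const_mul, h3, h4]
    simp only [List.map_cons, cups, ← hA]
    simp only [cup] at h1 ⊢
    rw [h1]
    ring

/-- The cochain on lists of labels that assigns to a permutation of `0, …, d` its sign and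
vanishes on other lists of that length. -/
noncomputable def orient (d : ℕ) (l : List ℕ) : ℤ :=
  Matrix.det (Matrix.of fun i j : Fin (d + 1) => if l[(i : ℕ)]? = some (j : ℕ) then (1 : ℤ) else 0)

lemma orient_eq_one {d : ℕ} {l : List ℕ} (h : ∀ i ≤ d, l[i]? = some i) : orient d l = 1 := by
  rw [orient, ← Matrix.det_one (n := Fin (d + 1))]
  congr 1
  ext i j
  simp [h i (by omega), Matrix.one_apply, Fin.ext_iff]

lemma exists_getElem?_of_orient_ne_zero {d : ℕ} {l : List ℕ} (h : orient d l ≠ 0) {j : ℕ}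
    (hj : j ≤ d) : ∃ i ≤ d, l[i]? = some j := by
  by_contra! H
  refine h (Matrix.det_eq_zero_of_column_eq_zero ⟨j, by omega⟩ fun i => ?_)
  simp [H i (by omega)]

lemma cobdry_orient {d : ℕ} {l : List ℕ} (hlen : l.length = d + 2) (hle : ∀ a ∈ l, a ≤ d + 1)
    {j : ℕ} (hj : j ≤ d + 1) (hjl : j ∉ l) : cobdry (orient d) l = 0 := by
  obtain ⟨f, rfl⟩ : ∃ f : Fin (d + 2) → ℕ, l = List.ofFn f :=
    ⟨fun i => l[(i : ℕ)], List.ext_getElem (by simp [hlen]) fun i _ _ => by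
      rw [List.getElem_ofFn]⟩
  let B : Matrix (Fin (d + 2)) (Fin (d + 2)) ℤ := Matrix.of fun i =>
    Fin.cons 1 fun j : Fin (d + 1) => if f i = j then 1 else 0
  have hB : cobdry (orient d) (List.ofFn f) = B.det := by
    rw [cobdry_ofFn, Matrix.det_succ_column_zero]
    refine Finset.sum_congr rfl fun i _ => ?_
    simp only [B, Matrix.of_apply, Fin.cons_zero, mul_one]
    congr 1
    rw [orient]
    congr 1
    ext a b
    simp only [Matrix.of_apply, List.getElem?_ofFn, Matrix.submatrix_apply, Fin.cons_succ]
    simp [Nat.lt_succ_iff.1 a.2]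
  rw [hB]
  rcases hj.lt_or_eq with hj' | rfl
  · refine Matrix.det_eq_zero_of_column_eq_zero (Fin.succ ⟨j, hj'⟩) fun i => ?_
    simp only [B, Matrix.of_apply, Fin.cons_succ]
    rw [if_neg]
    rintro rfl
    exact hjl (List.mem_ofFn.2 ⟨i, rfl⟩)
  · rw [← Matrix.exists_mulVec_eq_zero_iff]
    refine ⟨Fin.cons 1 fun _ => -1, fun h => by simpa using congrFun h 0, ?_⟩
    ext i
    have h1 : f i ≤ d + 1 := hle _ (List.mem_ofFn.2 ⟨i, rfl⟩)
    have h2 : f i ≠ d + 1 := fun h => hjl (List.mem_ofFn.2 ⟨i, h⟩)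
    rw [Matrix.mulVec, dotProduct, Fin.sum_univ_succ,
      Finset.sum_eq_single (⟨f i, by omega⟩ : Fin (d + 1))]
    · simp only [B, Matrix.of_apply, Fin.cons_zero, Fin.cons_succ]
      simp
    · intro b _ hb
      have : f i ≠ b := fun h => hb (by ext; exact h.symm)
      simp [B, this]
    · simp

/-- The `t`-th vertex of the simplex in the discrete torus `(ZMod L)^m` that starts at `x` and whose
edges increase the coordinates in the order `σ 0, σ 1, …`. -/
def vertex {m L : ℕ} (x : Fin m → ZMod L) (σ : Equiv.Perm (Fin m)) (t : ℕ) : Fin m → ZMod L :=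
  fun a => x a + if (σ.symm a : ℕ) < t then 1 else 0

/-- Evaluation of an `m`-cochain on the fundamental cycle of the discrete torus, mapped by `P`. -/
def torusSum {V : Type*} {m L : ℕ} [NeZero L] (P : (Fin m → ZMod L) → V) (c : List V → ℤ) : ℤ :=
  ∑ x : Fin m → ZMod L, ∑ σ : Equiv.Perm (Fin m),
    (Equiv.Perm.sign σ : ℤ) * c (List.ofFn fun t : Fin (m + 1) => P (vertex x σ t))

lemma vertex_mul_swap {m L : ℕ} (x : Fin (m + 1) → ZMod L) (σ : Equiv.Perm (Fin (m + 1)))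
    (i : Fin m) {t : ℕ} (ht : t ≠ i + 1) :
    vertex x (σ * Equiv.swap i.castSucc i.succ) t = vertex x σ t := by
  funext a
  have h : (σ * Equiv.swap i.castSucc i.succ).symm a
      = Equiv.swap i.castSucc i.succ (σ.symm a) := by
    rw [Equiv.symm_apply_eq]; simp
  simp only [vertex, h]
  congr 2
  rw [Equiv.swap_apply_def]
  split_ifs with h1 h2
  · rw [h1]; simp only [Fin.val_succ, Fin.val_castSucc, eq_iff_iff]; omega
  · rw [h2]; simp only [Fin.val_succ, Fin.val_castSucc, eq_iff_iff]; omega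
  · rfl

lemma vertex_mul_finRotate {m L : ℕ} (x : Fin (m + 1) → ZMod L) (σ : Equiv.Perm (Fin (m + 1)))
    {t : ℕ} (ht : t ≤ m) :
    vertex (x + Pi.single (σ 0) 1) (σ * finRotate (m + 1)) t = vertex x σ (t + 1) := by
  funext a
  obtain ⟨b, rfl⟩ := σ.surjective a
  have h : (σ * finRotate (m + 1)).symm (σ b) = (finRotate (m + 1)).symm b := by
    rw [Equiv.symm_apply_eq]; simp
  simp only [vertex, h, Pi.add_apply, Equiv.symm_apply_apply]
  rcases Fin.eq_zero_or_eq_succ b with rfl | ⟨j, rfl⟩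
  · have h0 : (finRotate (m + 1)).symm 0 = Fin.last m := by
      rw [Equiv.symm_apply_eq, finRotate_last]
    simp [h0, ht]
  · have h0 : (finRotate (m + 1)).symm j.succ = j.castSucc := by
      rw [Equiv.symm_apply_eq, finRotate_apply, Fin.coeSucc_eq_succ]
    simp [h0]

lemma torusSum_cobdry {V : Type*} {m L : ℕ} [NeZero L] (P : (Fin (m + 1) → ZMod L) → V)
    (c : List V → ℤ) : torusSum P (cobdry c) = 0 := by
  let F : Fin (m + 2) → ℤ := fun i => ∑ x : Fin (m + 1) → ZMod L,
    ∑ σ : Equiv.Perm (Fin (m + 1)), (Equiv.Perm.sign σ : ℤ) *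
      c (List.ofFn fun t : Fin (m + 1) => P (vertex x σ (i.succAbove t)))
  have h1 : torusSum P (cobdry c) = ∑ i : Fin (m + 2), (-1) ^ (i : ℕ) * F i := by
    simp only [torusSum, cobdry_ofFn, F, Finset.mul_sum]
    conv_rhs => rw [Finset.sum_comm]
    refine Finset.sum_congr rfl fun x _ => ?_
    conv_rhs => rw [Finset.sum_comm]
    refine Finset.sum_congr rfl fun σ _ => Finset.sum_congr rfl fun i _ => ?_
    simp only [Function.comp_def]
    ring
  have hmid : ∀ i : Fin m, F i.succ.castSucc = 0 := by
    intro i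
    have : F i.succ.castSucc = - F i.succ.castSucc := by
      simp only [F, ← Finset.sum_neg_distrib]
      refine Finset.sum_congr rfl fun x _ => ?_
      rw [← Equiv.sum_comp (Equiv.mulRight (Equiv.swap i.castSucc i.succ))]
      refine Finset.sum_congr rfl fun σ _ => ?_
      have hv : ∀ t : Fin (m + 1), vertex x (σ * Equiv.swap i.castSucc i.succ)
          (i.succ.castSucc.succAbove t) = vertex x σ (i.succ.castSucc.succAbove t) := by
        intro t
        refine vertex_mul_swap _ _ _ fun h => ?_
        exact Fin.succAbove_ne i.succ.castSucc t (by ext; simpa using h)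
      simp only [Equiv.coe_mulRight, hv, Equiv.Perm.sign_mul,
        Equiv.Perm.sign_swap (Fin.castSucc_lt_succ (i := i)).ne]
      push_cast
      ring
    omega
  have h0 : F 0 = (-1) ^ m * F (Fin.last (m + 1)) := by
    simp only [F, Fin.zero_succAbove, Fin.succAbove_last, Fin.val_succ, Fin.val_castSucc]
    conv_lhs => rw [Finset.sum_comm]
    conv_rhs => rw [Finset.sum_comm, ← Equiv.sum_comp (Equiv.mulRight (finRotate (m + 1)))]
    rw [Finset.mul_sum]
    refine Finset.sum_congr rfl fun σ _ => ?_
    conv_rhs => rw [← Equiv.sum_comp (Equiv.addRight (Pi.single (σ 0) (1 : ZMod L)))]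
    rw [Finset.mul_sum]
    refine Finset.sum_congr rfl fun x _ => ?_
    have hv : ∀ t : Fin (m + 1), vertex (x + Pi.single (σ 0) 1) (σ * finRotate (m + 1)) t
        = vertex x σ (t + 1) := fun t => vertex_mul_finRotate _ _ (by omega)
    simp only [Equiv.coe_mulRight, Equiv.coe_addRight, hv, Equiv.Perm.sign_mul, sign_finRotate]
    push_cast
    rw [mul_comm (Equiv.Perm.sign σ : ℤ) ((-1) ^ m), ← mul_assoc, ← mul_assoc, ← mul_pow]
    simp
  rw [h1, Fin.sum_univ_succ, Fin.sum_univ_castSucc]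
  simp only [Fin.succ_castSucc, hmid, mul_zero, Finset.sum_const_zero, zero_add, h0,
    Fin.succ_last, Fin.val_last, Fin.val_zero, pow_zero, one_mul]
  rw [pow_succ]
  ring

/-- A labelling of `ℝ^(d+1)` by `0, …, d + 1` such that near each nonzero vector some label is
not attained. -/
noncomputable def label {d : ℕ} (v : EuclideanSpace ℝ (Fin (d + 1))) : ℕ :=
  open Classical in
  if 0 ≤ v (Fin.last d) then d + 1
  else sInf {j : ℕ | j = d ∨ ∃ i : Fin d, (i : ℕ) = j ∧ v i.castSucc < 0}

lemma label_eq_iff {d : ℕ} (v : EuclideanSpace ℝ (Fin (d + 1))) {j : ℕ} (hj : j ≤ d) :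
    label v = j ↔ v (Fin.last d) < 0 ∧ (∀ i : Fin d, (i : ℕ) < j → 0 ≤ v i.castSucc) ∧
      ∀ i : Fin d, (i : ℕ) = j → v i.castSucc < 0 := by
  rw [label]
  split_ifs with h
  · constructor
    · intro h'; omega
    · intro h'; exact absurd h'.1 (not_lt.2 h)
  · have hne : {j : ℕ | j = d ∨ ∃ i : Fin d, (i : ℕ) = j ∧ v i.castSucc < 0}.Nonempty :=
      ⟨d, Or.inl rfl⟩
    have hmem := Nat.sInf_mem hne
    constructor
    · intro hs
      rw [hs] at hmem
      refine ⟨not_le.1 h, fun i hi => ?_, ?_⟩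
      · by_contra! hv
        exact Nat.notMem_of_lt_sInf (hs ▸ hi) (Or.inr ⟨i, rfl, hv⟩)
      · intro i hi
        rcases hmem with hmem | ⟨i', hi', hv⟩
        · exact absurd i.2 (by omega)
        · obtain rfl : i = i' := Fin.ext (hi.trans hi'.symm)
          exact hv
    · rintro ⟨-, h1, h2⟩
      apply le_antisymm
      · apply Nat.sInf_le
        rcases hj.lt_or_eq with hj | rfl
        · exact Or.inr ⟨⟨j, hj⟩, rfl, h2 _ rfl⟩
        · exact Or.inl rfl
      · rcases hmem with hmem | ⟨i', hi', hv⟩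
        · rw [hmem]; exact hj
        · by_contra! hlt
          exact absurd hv (not_lt.2 (h1 i' (by omega)))

lemma label_le {d : ℕ} (v : EuclideanSpace ℝ (Fin (d + 1))) : label v ≤ d + 1 := by
  rw [label]
  split_ifs
  · exact le_rfl
  · exact (Nat.sInf_le (Or.inl rfl)).trans (Nat.le_succ d)

lemma exists_eventually_label_ne {d : ℕ} {v : EuclideanSpace ℝ (Fin (d + 1))} (hv : v ≠ 0) :
    ∃ j ≤ d + 1, ∀ᶠ w in 𝓝 v, label w ≠ j := by
  have hc : ∀ i : Fin (d + 1), Filter.Tendsto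
      (fun w : EuclideanSpace ℝ (Fin (d + 1)) => w i) (𝓝 v) (𝓝 (v i)) := fun i =>
    (EuclideanSpace.proj (𝕜 := ℝ) i).continuous.tendsto v
  rcases lt_trichotomy (v (Fin.last d)) 0 with h | h | h
  · refine ⟨d + 1, le_rfl, ?_⟩
    filter_upwards [(hc (Fin.last d)).eventually_lt_const h] with w hw hl
    rw [label, if_neg (not_le.2 hw)] at hl
    have : sInf {j : ℕ | j = d ∨ ∃ i : Fin d, (i : ℕ) = j ∧ w i.castSucc < 0} ≤ d :=
      Nat.sInf_le (Or.inl rfl)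
    omega
  · obtain ⟨i, hi⟩ : ∃ i : Fin d, v i.castSucc ≠ 0 := by
      by_contra! H
      refine hv (PiLp.ext fun i => ?_)
      induction i using Fin.lastCases with
      | last => exact h
      | cast i => exact H i
    rcases hi.lt_or_gt with hi | hi
    · refine ⟨d, Nat.le_succ d, ?_⟩
      filter_upwards [(hc i.castSucc).eventually_lt_const hi] with w hw hl
      exact absurd hw (not_lt.2 (((label_eq_iff w le_rfl).1 hl).2.1 i i.2))
    · refine ⟨i, by omega, ?_⟩
      filter_upwards [(hc i.castSucc).eventually_const_lt hi] with w hw hl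
      exact absurd hw (not_lt.2 (((label_eq_iff w i.2.le).1 hl).2.2 i rfl).le)
  · refine ⟨0, Nat.zero_le _, ?_⟩
    filter_upwards [(hc (Fin.last d)).eventually_const_lt h] with w hw hl
    rw [label, if_pos hw.le] at hl
    omega

/-- The complement of the origin in `ℝ^(d+1)`. -/
abbrev Punctured (d : ℕ) : Type := {v : EuclideanSpace ℝ (Fin (d + 1)) // v ≠ 0}

/-- Lists of points of diameter less than `ε`. -/
def Small {X : Type*} [MetricSpace X] (ε : ℝ) (l : List X) : Prop :=
  ∀ a ∈ l, ∀ b ∈ l, dist a b < ε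

lemma Small.of_sublist {X : Type*} [MetricSpace X] {ε : ℝ} {l l' : List X}
    (h : l'.Sublist l) (hl : Small ε l) : Small ε l' :=
  fun a ha b hb => hl a (h.subset ha) b (h.subset hb)

lemma Small.mono {X : Type*} [MetricSpace X] {ε δ : ℝ} {l : List X}
    (h : ε ≤ δ) (hl : Small ε l) : Small δ l :=
  fun a ha b hb => (hl a ha b hb).trans_le h

/-- The `d`-cochain representing the pullback of the generator along a map to the punctured
space. -/
noncomputable def pullback {X : Type*} {d : ℕ} (f : X → Punctured d) (l : List X) : ℤ :=
  orient d (l.map fun x => label (f x : EuclideanSpace ℝ (Fin (d + 1))))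

lemma exists_label_ne_of_compact {Y : Type*} [PseudoMetricSpace Y] [CompactSpace Y] {d : ℕ}
    (f : C(Y, Punctured d)) :
    ∃ ε > 0, ∀ y : Y, ∃ j ≤ d + 1, ∀ z, dist z y < ε →
      label (f z : EuclideanSpace ℝ (Fin (d + 1))) ≠ j := by
  obtain ⟨ε, hε, h⟩ := lebesgue_number_lemma_of_metric (s := (Set.univ : Set Y))
    (c := fun j : Fin (d + 2) =>
      interior {y | label (f y : EuclideanSpace ℝ (Fin (d + 1))) ≠ j})
    isCompact_univ (fun _ => isOpen_interior) fun y _ => by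
      obtain ⟨j, hj, h⟩ := exists_eventually_label_ne (f y).2
      refine Set.mem_iUnion.2 ⟨⟨j, by omega⟩, mem_interior_iff_mem_nhds.2 ?_⟩
      exact (continuous_subtype_val.comp f.continuous).continuousAt h
  refine ⟨ε, hε, fun y => ?_⟩
  obtain ⟨j, hj⟩ := h y trivial
  exact ⟨j, by omega, fun z hz => interior_subset (hj hz)⟩

lemma exists_cobdry_pullback_eq_zero {X : Type*} [MetricSpace X] [CompactSpace X] {d : ℕ}
    (f : C(X, Punctured d)) :
    ∃ ε > 0, ∀ l, Small ε l → l.length = d + 2 → cobdry (pullback f) l = 0 := by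
  obtain ⟨ε, hε, h⟩ := exists_label_ne_of_compact f
  refine ⟨ε, hε, fun l hl hlen => ?_⟩
  match l, hlen with
  | x :: l, hlen =>
    obtain ⟨j, hj, hjz⟩ := h x
    have := cobdry_map (fun x => label (f x : EuclideanSpace ℝ (Fin (d + 1)))) (orient d) (x :: l)
    refine this.trans (cobdry_orient (by simpa using hlen) ?_ hj ?_)
    · intro a ha
      obtain ⟨z, -, rfl⟩ := List.mem_map.1 ha
      exact label_le _
    · intro ha
      obtain ⟨z, hz, hzj⟩ := List.mem_map.1 ha
      exact hjz z (hl z hz x (by simp)) hzj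

lemma exists_pullback_sub_eq_cobdry {X : Type*} [MetricSpace X] {d : ℕ}
    {K U : Set X} (hK : IsCompact K) (hKU : K ⊆ U) (f g : C(X, Punctured d))
    (hfg : (f.restrict U).Homotopic (g.restrict U)) :
    ∃ ε > 0, ∃ c : List X → ℤ, ∀ l, Small ε l → (∀ x ∈ l, x ∈ K) → l.length = d + 1 →
      pullback f l - pullback g l = cobdry c l := by
  classical
  obtain ⟨F⟩ := hfg
  have : CompactSpace K := isCompact_iff_compactSpace.1 hK
  let G : C(K × unitInterval, Punctured d) :=
    ⟨fun z => F (z.2, Set.inclusion hKU z.1), by fun_prop⟩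
  obtain ⟨ε, hε, h⟩ := exists_label_ne_of_compact G
  obtain ⟨n, hn⟩ := exists_nat_one_div_lt hε
  let τ : ℕ → unitInterval := fun i => Set.projIcc 0 1 zero_le_one ((i : ℝ) / (n + 1))
  have hτ : ∀ i, dist (τ (i + 1)) (τ i) < ε := by
    intro i
    refine lt_of_le_of_lt ((LipschitzWith.projIcc _).dist_le_mul _ _) (lt_of_eq_of_lt ?_ hn)
    rw [Real.dist_eq]
    push_cast
    rw [one_mul, ← sub_div, add_sub_cancel_left, abs_of_nonneg (by positivity)]
  let Λ : ℕ → X → ℕ := fun i x =>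
    if hx : x ∈ K then label (G (⟨x, hx⟩, τ i) : EuclideanSpace ℝ (Fin (d + 1))) else 0
  refine ⟨ε, hε, fun l => -1 * ∑ i ∈ Finset.range (n + 1), prism (Λ i) (Λ (i + 1)) (orient d) l,
    fun l hl hlK hlen => ?_⟩
  have hstep : ∀ i, cobdry (prism (Λ i) (Λ (i + 1)) (orient d)) l
      = orient d (l.map (Λ (i + 1))) - orient d (l.map (Λ i)) := by
    intro i
    have := cobdry_prism (Λ i) (Λ (i + 1)) (orient d) l
    rw [← this, left_eq_add]
    match l, hlen with
    | x :: l, hlen =>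
      obtain ⟨j, hj, hjz⟩ := h (⟨x, hlK x (by simp)⟩, τ i)
      refine prism_eq_zero (S := {a | a ≤ d + 1 ∧ a ≠ j}) ?_ ?_ ?_
      · intro l' hl' hmem
        exact cobdry_orient (by omega) (fun a ha => (hmem a ha).1) hj fun ha => (hmem j ha).2 rfl
      · intro y hy
        have hyK := hlK y hy
        simp only [Λ, hyK, dif_pos, Set.mem_ofPred_eq]
        refine ⟨label_le _, hjz _ ?_⟩
        rw [Prod.dist_eq]
        exact max_lt (hl y hy x (by simp)) (by simpa using hε)
      · intro y hy
        have hyK := hlK y hy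
        simp only [Λ, hyK, dif_pos, Set.mem_ofPred_eq]
        refine ⟨label_le _, hjz _ ?_⟩
        rw [Prod.dist_eq]
        exact max_lt (hl y hy x (by simp)) (hτ i)
  rw [cobdry_const_mul, cobdry_sum, Finset.sum_congr rfl fun i _ => hstep i,
    Finset.sum_range_sub (fun i => orient d (l.map (Λ i)))]
  have h0 : τ 0 = 0 := by simp [τ]
  have h1 : τ (n + 1) = 1 := by
    have : ((n : ℝ) + 1) / (n + 1) = 1 := div_self (by positivity)
    simp [τ, this]
  have e0 : l.map (Λ 0) = l.map fun x => label (f x : EuclideanSpace ℝ (Fin (d + 1))) := by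
    refine List.map_congr_left fun x hx => ?_
    simp [Λ, hlK x hx, h0, G]
  have e1 : l.map (Λ (n + 1)) = l.map fun x => label (g x : EuclideanSpace ℝ (Fin (d + 1))) := by
    refine List.map_congr_left fun x hx => ?_
    simp [Λ, hlK x hx, h1, G]
  rw [e0, e1, pullback, pullback]
  ring

lemma cups_eq_zero {V : Type*} {d : ℕ} {as : List (List V → ℤ)} {a : List V → ℤ} (ha : a ∈ as)
    {l : List V} (hlen : l.length = as.length * d + 1)
    (h : ∀ l' : List V, l'.Sublist l → l'.length = d + 1 → a l' = 0) : cups d as l = 0 := by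
  induction as generalizing l with
  | nil => simp at ha
  | cons b as ih =>
    simp only [List.length_cons, add_mul, one_mul] at hlen
    rw [cups, cup]
    rcases List.mem_cons.1 ha with rfl | ha
    · rw [h _ (List.take_sublist _ _) (by rw [List.length_take]; omega), zero_mul]
    · rw [ih ha (by rw [List.length_drop]; omega) fun l' hl' =>
        h l' (hl'.trans (List.drop_sublist _ _)), mul_zero]

/-- If the maps in `N` pairs are homotopic on the respective members of an open cover, then the
product of the differences of their pullback classes is a coboundary on small simplices. -/
theorem exists_cups_eq_cobdry {X : Type*} [MetricSpace X] [CompactSpace X] {p N : ℕ}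
    (f g : Fin N → C(X, Punctured (p + 1))) (U : Fin N → Set X) (hU : ∀ i, IsOpen (U i))
    (hcov : ⋃ i, U i = Set.univ)
    (hfg : ∀ i, ((f i).restrict (U i)).Homotopic ((g i).restrict (U i))) :
    ∃ ε > 0, ∃ c : List X → ℤ, ∀ l, Small ε l → l.length = N * (p + 1) + 1 →
      cups (p + 1) (List.ofFn fun i l => pullback (f i) l - pullback (g i) l) l = cobdry c l := by
  classical
  obtain ⟨v, hvcov, hvo, hvU⟩ := exists_iUnion_eq_closure_subset hU
    (fun x => Set.toFinite _) hcov
  choose ε₁ hε₁ c hc using fun i =>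
    exists_pullback_sub_eq_cobdry (isClosed_closure (s := v i)).isCompact (hvU i) (f i) (g i)
      (hfg i)
  choose ε₂ hε₂ hf using fun i => exists_cobdry_pullback_eq_zero (f i)
  choose ε₃ hε₃ hg using fun i => exists_cobdry_pullback_eq_zero (g i)
  obtain ⟨ε₀, hε₀, hleb⟩ := lebesgue_number_lemma_of_metric (s := (Set.univ : Set X)) (c := v)
    isCompact_univ hvo hvcov.ge
  obtain ⟨ε, hε, hle⟩ : ∃ ε > 0, ∀ i, ε ≤ ε₀ ∧ ε ≤ ε₁ i ∧ ε ≤ ε₂ i ∧ ε ≤ ε₃ i := by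
    have hev : ∀ᶠ ε : ℝ in 𝓝[>] 0, ∀ i, ε ≤ ε₀ ∧ ε ≤ ε₁ i ∧ ε ≤ ε₂ i ∧ ε ≤ ε₃ i := by
      have key : ∀ r : ℝ, 0 < r → ∀ᶠ ε : ℝ in 𝓝[>] 0, ε ≤ r := fun r hr =>
        nhdsWithin_le_nhds (Iic_mem_nhds hr)
      exact Filter.eventually_all.2 fun i => (key _ hε₀).and ((key _ (hε₁ i)).and
        ((key _ (hε₂ i)).and (key _ (hε₃ i))))
    obtain ⟨ε, h1, h2⟩ := (hev.and self_mem_nhdsWithin).exists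
    exact ⟨ε, h2, h1⟩
  let η : Fin N → List X → ℤ := fun i l => if ∀ x ∈ l, x ∈ closure (v i) then c i l else 0
  obtain ⟨C, -, hC⟩ := exists_cups_sub_eq_cobdry (S := Small ε) (p := p)
    (fun l l' h hl => hl.of_sublist h)
    (List.ofFn fun i => ((fun l => pullback (f i) l - pullback (g i) l : List X → ℤ), η i)) (by
      intro a ha l hl hlen
      obtain ⟨i, rfl⟩ := List.mem_ofFn.1 ha
      rw [cobdry_sub, hf i l (hl.mono (hle i).2.2.1) hlen, hg i l (hl.mono (hle i).2.2.2) hlen,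
        sub_zero])
  refine ⟨ε, hε, C, fun l hl hlen => ?_⟩
  have h := hC l hl (by simpa using hlen)
  rw [List.map_ofFn, List.map_ofFn] at h
  simp only [Function.comp_def] at h
  rw [← sub_eq_zero, ← h]
  match l, hlen with
  | x :: l, hlen =>
    obtain ⟨i, hi⟩ := hleb x trivial
    refine cups_eq_zero (List.mem_ofFn.2 ⟨i, rfl⟩) (by simpa using hlen) fun l' hl' hlen' => ?_
    have hmem : ∀ y ∈ l', y ∈ closure (v i) := fun y hy => subset_closure
      (hi ((hl y (hl'.subset hy) x (by simp)).trans_le (hle i).1))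
    have hη : cobdry (η i) l' = cobdry (c i) l' := cobdry_congr fun l'' hl'' _ => by
      simp only [η]
      rw [if_pos fun y hy => hmem y (hl''.subset hy)]
    rw [hη, hc i l' ((hl.of_sublist hl').mono (hle i).2.1) hmem hlen', sub_self]

lemma ofFn_comp_val {V : Type*} (f : ℕ → V) (n : ℕ) :
    List.ofFn (fun t : Fin n => f t) = (List.range n).map f :=
  List.ext_getElem (by simp) fun i _ _ => by simp

lemma cups_ofFn {V : Type*} {d N : ℕ} (a : Fin N → List V → ℤ) (f : ℕ → V) :
    cups d (List.ofFn a) (List.ofFn fun t : Fin (N * d + 1) => f t)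
      = ∏ l : Fin N, a l (List.ofFn fun t : Fin (d + 1) => f (l * d + t)) := by
  simp only [fun i : ℕ => ofFn_comp_val (fun t => f (i * d + t)) (d + 1), ofFn_comp_val f]
  induction N generalizing f with
  | zero => simp [cups]
  | succ N ih =>
    rw [List.ofFn_succ, cups, cup, Fin.prod_univ_succ]
    congr 1
    · congr 1
      refine List.ext_getElem (by simp; nlinarith) fun i _ _ => by simp
    · have : ((List.range ((N + 1) * d + 1)).map f).drop d
          = (List.range (N * d + 1)).map fun t => f (d + t) :=
        List.ext_getElem (by simp; ring_nf; omega) fun i _ _ => by simp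
      rw [this, ih]
      refine Finset.prod_congr rfl fun i _ => ?_
      congr 1
      refine List.map_congr_left fun t _ => ?_
      congr 1
      simp only [Fin.val_succ]
      ring

lemma cups_ofFn_sum {V : Type*} {d N : ℕ} {ι : Type*} [Fintype ι] [DecidableEq ι]
    (A : Fin N → ι → ℤ) (b : ι → List V → ℤ) (f : ℕ → V) :
    cups d (List.ofFn fun l l' => ∑ i, A l i * b i l') (List.ofFn fun t : Fin (N * d + 1) => f t)
      = ∑ c : Fin N → ι, (∏ l, A l (c l)) *
        cups d (List.ofFn fun l => b (c l)) (List.ofFn fun t : Fin (N * d + 1) => f t) := by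
  simp only [cups_ofFn, Finset.prod_univ_sum, Finset.prod_mul_distrib, Fintype.piFinset_univ]

lemma toCircle_im {L : ℕ} [NeZero L] (a : ZMod L) :
    (ZMod.toCircle a : ℂ).im = Real.sin (2 * Real.pi * (a.val / L)) := by
  rw [ZMod.toCircle_apply, ← Complex.exp_ofReal_mul_I_im]
  congr 2; push_cast; ring

lemma toCircle_re {L : ℕ} [NeZero L] (a : ZMod L) :
    (ZMod.toCircle a : ℂ).re = Real.cos (2 * Real.pi * (a.val / L)) := by
  rw [ZMod.toCircle_apply, ← Complex.exp_ofReal_mul_I_re]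
  congr 2; push_cast; ring

lemma toCircle_im_nonneg_iff {L : ℕ} [NeZero L] (a : ZMod L) :
    0 ≤ (ZMod.toCircle a : ℂ).im ↔ 2 * a.val ≤ L := by
  have hL : (0 : ℝ) < L := Nat.cast_pos.2 (NeZero.pos L)
  have hv : (a.val : ℝ) / L < 1 := (div_lt_one hL).2 (Nat.cast_lt.2 a.val_lt)
  have hv0 : 0 ≤ (a.val : ℝ) / L := by positivity
  have hpi := Real.pi_pos
  have key : 2 * a.val ≤ L ↔ 2 * ((a.val : ℝ) / L) ≤ 1 := by
    rw [← mul_div_assoc, div_le_one hL]; exact_mod_cast Iff.rfl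
  rw [toCircle_im, key]
  constructor
  · intro h
    by_contra! h'
    have := Real.sin_pos_of_pos_of_lt_pi (x := 2 * Real.pi * (a.val / L) - Real.pi)
      (by nlinarith) (by nlinarith)
    rw [Real.sin_sub_pi] at this
    linarith
  · intro h
    exact Real.sin_nonneg_of_nonneg_of_le_pi (by positivity) (by nlinarith)

lemma eq_neg_one_of_toCircle_im {L : ℕ} [NeZero L] (hL : 3 ≤ L) {a : ZMod L}
    (h : (ZMod.toCircle a : ℂ).im < 0) (h' : 0 ≤ (ZMod.toCircle (a + 1) : ℂ).im) : a = -1 := by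
  rw [← not_le, toCircle_im_nonneg_iff] at h
  rw [toCircle_im_nonneg_iff] at h'
  have : Fact (1 < L) := ⟨by omega⟩
  have hlt := a.val_lt
  rcases Nat.lt_or_ge (a.val + 1) L with h1 | h1
  · rw [ZMod.val_add_of_lt (by rwa [ZMod.val_one]), ZMod.val_one] at h'
    omega
  · have h2 : a.val + 1 = L := by omega
    have : a + 1 = 0 := by
      rw [← ZMod.natCast_zmod_val a]
      have := congrArg (Nat.cast : ℕ → ZMod L) h2
      simpa using this
    exact eq_neg_of_add_eq_zero_left this

lemma toCircle_im_nonneg_of_re {L : ℕ} [NeZero L] (hL : 6 ≤ L) {a : ZMod L}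
    (h : 0 ≤ (ZMod.toCircle a : ℂ).im) (hre : 1 / 2 < (ZMod.toCircle a : ℂ).re) :
    0 ≤ (ZMod.toCircle (a + 1) : ℂ).im := by
  rw [toCircle_im_nonneg_iff] at h ⊢
  have : Fact (1 < L) := ⟨by omega⟩
  have hL0 : (0 : ℝ) < L := Nat.cast_pos.2 (NeZero.pos L)
  have hpi := Real.pi_pos
  have h2 : 2 * ((a.val : ℝ) / L) ≤ 1 := by
    rw [← mul_div_assoc, div_le_one hL0]; exact_mod_cast h
  have h3 : 6 * ((a.val : ℝ) / L) < 1 := by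
    by_contra! h3
    rw [toCircle_re, ← Real.cos_pi_div_three] at hre
    exact absurd (Real.cos_le_cos_of_nonneg_of_le_pi (by positivity) (by nlinarith)
      (by nlinarith : Real.pi / 3 ≤ 2 * Real.pi * (a.val / L))) (not_le.2 hre)
  rw [← mul_div_assoc, div_lt_one hL0] at h3
  have h4 : 6 * a.val < L := by exact_mod_cast h3
  rw [ZMod.val_add_of_lt (by rw [ZMod.val_one]; omega), ZMod.val_one]
  omega

lemma toCircle_neg_one_im_neg {L : ℕ} [NeZero L] (hL : 3 ≤ L) :
    (ZMod.toCircle (-1 : ZMod L) : ℂ).im < 0 := by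
  rw [← not_le, toCircle_im_nonneg_iff]
  obtain ⟨L, rfl⟩ : ∃ n, L = n + 1 := ⟨L - 1, by omega⟩
  rw [ZMod.val_neg_one]
  omega

/-- A map of degree one from the `d`-torus to the punctured space. -/
noncomputable def torusMap (d : ℕ) : C(Fin d → Circle, Punctured d) where
  toFun z := ⟨WithLp.toLp 2 (Fin.snoc (fun i => (z i : ℂ).im)
    ((d : ℝ) - 1 / 2 - ∑ i, (z i : ℂ).re)), fun h => by
      have h1 : ∀ i : Fin d, (z i : ℂ).im = 0 := fun i => by
        simpa using congrArg (fun v : EuclideanSpace ℝ (Fin (d + 1)) => v i.castSucc) h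
      have h2 : (d : ℝ) - 1 / 2 - ∑ i, (z i : ℂ).re = 0 := by
        simpa using congrArg (fun v : EuclideanSpace ℝ (Fin (d + 1)) => v (Fin.last d)) h
      have h3 : ∀ i, (z i : ℂ).re = 1 ∨ (z i : ℂ).re = -1 := fun i => by
        have := Circle.normSq_coe (z i)
        rw [Complex.normSq_apply, h1 i] at this
        exact mul_self_eq_one_iff.1 (by linarith)
      by_cases h4 : ∀ i, (z i : ℂ).re = 1
      · simp [h4] at h2
      · push Not at h4
        obtain ⟨i, hi⟩ := h4
        have h5 : ∑ j, (1 - (z j : ℂ).re) = 1 / 2 := by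
          rw [Finset.sum_sub_distrib]; simp; linarith
        have h6 := Finset.single_le_sum (f := fun j => 1 - (z j : ℂ).re) (fun j _ => by
          rcases h3 j with h | h <;> rw [h] <;> norm_num) (Finset.mem_univ i)
        rw [h5] at h6
        simp only [(h3 i).resolve_left hi] at h6
        norm_num at h6⟩
  continuous_toFun := by
    refine Continuous.subtype_mk ((PiLp.continuous_toLp 2 _).comp (continuous_pi fun i => ?_)) _
    induction i using Fin.lastCases with
    | last => simp only [Fin.snoc_last]; fun_prop
    | cast i => simp only [Fin.snoc_castSucc]; fun_prop

lemma label_torusMap_eq_iff {d j : ℕ} (hj : j ≤ d) (z : Fin d → Circle) :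
    label (torusMap d z : EuclideanSpace ℝ (Fin (d + 1))) = j ↔
      ∑ i, (1 - (z i : ℂ).re) < 1 / 2 ∧ (∀ i : Fin d, (i : ℕ) < j → 0 ≤ (z i : ℂ).im) ∧
        ∀ i : Fin d, (i : ℕ) = j → (z i : ℂ).im < 0 := by
  rw [label_eq_iff _ hj]
  simp only [torusMap, ContinuousMap.coe_mk, Fin.snoc_last, Fin.snoc_castSucc]
  refine and_congr_left' ?_
  rw [Finset.sum_sub_distrib]
  simp only [Finset.sum_const, Finset.card_univ, Fintype.card_fin, nsmul_eq_mul, mul_one]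
  constructor <;> intro h <;> linarith

lemma half_lt_re_of_sum_lt {d : ℕ} {z : Fin d → Circle} (h : ∑ i, (1 - (z i : ℂ).re) < 1 / 2)
    (i : Fin d) : 1 / 2 < (z i : ℂ).re := by
  have := Finset.single_le_sum (f := fun j => 1 - (z j : ℂ).re) (fun j _ => by
    have := (Complex.re_le_norm (z j)).trans_eq (Circle.norm_coe _)
    simpa using this) (Finset.mem_univ i)
  linarith

/-- The map from the `(N * d)`-torus given by `torusMap d` on the `l`-th block of coordinates. -/
noncomputable def blockMap {N : ℕ} (d : ℕ) (l : Fin N) :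
    C(Fin (N * d) → Circle, Punctured d) :=
  (torusMap d).comp ⟨fun y i => y (finProdFinEquiv (l, i)), by fun_prop⟩

/-- The grid in the torus. -/
noncomputable def gridMap {m L : ℕ} [NeZero L] (x : Fin m → ZMod L) : Fin m → Circle :=
  fun a => ZMod.toCircle (x a)

lemma exists_small_vertex (m : ℕ) {ε : ℝ} (hε : 0 < ε) :
    ∃ L₀ : ℕ, ∀ L ≥ L₀, ∀ [NeZero L], ∀ (x : Fin m → ZMod L) (σ : Equiv.Perm (Fin m)),
      Small ε (List.ofFn fun t : Fin (m + 1) => gridMap (vertex x σ t)) := by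
  obtain ⟨L₀, hL₀⟩ : ∃ L₀ : ℕ, ∀ L ≥ L₀, ∀ [NeZero L],
      dist (ZMod.toCircle (1 : ZMod L)) 1 < ε := by
    have ht : Filter.Tendsto (fun L : ℕ => Circle.exp (2 * Real.pi / L)) Filter.atTop (𝓝 1) := by
      have := Circle.exp.continuous.tendsto 0
      rw [Circle.exp_zero] at this
      exact this.comp (tendsto_const_div_atTop_nhds_zero_nat _)
    obtain ⟨L₀, h⟩ := Filter.eventually_atTop.1 (ht.eventually (Metric.ball_mem_nhds 1 hε))
    refine ⟨L₀, fun L hL _ => ?_⟩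
    have := h L hL
    change dist _ _ < ε at this
    convert this using 2
    have h1 := ZMod.toCircle_intCast (N := L) 1
    ext
    rw [Int.cast_one] at h1
    rw [h1, Circle.coe_exp]
    congr 1; push_cast; ring
  refine ⟨L₀, fun L hL _ x σ => ?_⟩
  have hd : ∀ z w : Circle, dist (z * w) z = dist w 1 := fun z w => by
    change dist ((z * w : Circle) : ℂ) (z : ℂ) = dist (w : ℂ) ((1 : Circle) : ℂ)
    rw [Complex.dist_eq, Complex.dist_eq, Circle.coe_mul, ← mul_sub_one, norm_mul, Circle.norm_coe, one_mul, Circle.coe_one]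
  intro a ha b hb
  obtain ⟨s, rfl⟩ := List.mem_ofFn.1 ha
  obtain ⟨t, rfl⟩ := List.mem_ofFn.1 hb
  rw [dist_pi_lt_iff hε]
  intro i
  have h1 := hL₀ L hL
  have h2 := hd (ZMod.toCircle (x i)) (ZMod.toCircle (1 : ZMod L))
  simp only [gridMap, vertex]
  split_ifs <;> simp only [add_zero, AddChar.map_add_eq_mul, dist_self, hε]
  · rwa [h2]
  · rwa [dist_comm, h2]

/-- Nonvanishing of the pullback of all the blocks on a simplex of the grid determines it. -/
lemma vertex_of_pullback_ne_zero {N d L : ℕ} [NeZero L] (hL : 6 ≤ L) {c : Fin N → Fin N}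
    {x : Fin (N * d) → ZMod L} {σ : Equiv.Perm (Fin (N * d))} {l : Fin N}
    (h : pullback (blockMap d (c l))
      (List.ofFn fun t : Fin (d + 1) => gridMap (vertex x σ (l * d + t))) ≠ 0) (i : Fin d) :
    x (finProdFinEquiv (c l, i)) = -1 ∧
      σ.symm (finProdFinEquiv (c l, i)) = finProdFinEquiv (l, i) := by
  have h1 : ∀ j : ℕ, ∃ p : ℕ, j ≤ d → p ≤ d ∧
      label (blockMap d (c l) (gridMap (vertex x σ (l * d + p))) :
        EuclideanSpace ℝ (Fin (d + 1))) = j := by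
    intro j
    by_cases hj : j ≤ d
    · obtain ⟨p, hp, hpj⟩ := exists_getElem?_of_orient_ne_zero h hj
      refine ⟨p, fun _ => ⟨hp, ?_⟩⟩
      rw [List.getElem?_map, List.getElem?_ofFn] at hpj
      simpa [Nat.lt_succ_iff.2 hp] using hpj
    · exact ⟨0, fun h => absurd h hj⟩
  choose p hp using h1
  have h2 : ∀ j ≤ d, _ := fun j hj => (label_torusMap_eq_iff hj _).1 (hp j hj).2
  simp only [gridMap, vertex, ContinuousMap.coe_mk] at h2
  have h3 : ∀ j (hj : j < d), let a := finProdFinEquiv (c l, ⟨j, hj⟩)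
      x a = -1 ∧ l * d + p j ≤ (σ.symm a : ℕ) ∧ (σ.symm a : ℕ) < l * d + p (j + 1) := by
    intro j hj a
    have hN := (h2 j hj.le).2.2 ⟨j, hj⟩ rfl
    have hP := (h2 (j + 1) hj).2.1 ⟨j, hj⟩ (Nat.lt_succ_self j)
    have hre := half_lt_re_of_sum_lt (h2 (j + 1) hj).1 ⟨j, hj⟩
    change (ZMod.toCircle (x a + if (σ.symm a : ℕ) < l * d + p j then 1 else 0) : ℂ).im < 0 at hN
    change 0 ≤ (ZMod.toCircle (x a + if (σ.symm a : ℕ) < l * d + p (j + 1) then 1 else 0) : ℂ).im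
      at hP
    change _ < (ZMod.toCircle (x a + if (σ.symm a : ℕ) < l * d + p (j + 1) then 1 else 0) : ℂ).re
      at hre
    split_ifs at hN hP hre with h4 h5
    · exact absurd hN (not_lt.2 hP)
    · rw [add_zero] at hP hre
      exact absurd hN (not_lt.2 (toCircle_im_nonneg_of_re hL hP hre))
    · rw [add_zero] at hN
      exact ⟨eq_neg_one_of_toCircle_im (by omega) hN hP, by omega, by omega⟩
    · exact absurd hN (not_lt.2 hP)
  have h4 : ∀ j ≤ d, j ≤ p j := by
    intro j hj
    induction j with
    | zero => exact Nat.zero_le _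
    | succ j ih =>
      have := ih (by omega)
      have := h3 j hj
      omega
  have h5 : ∀ j ≤ d, p (d - j) ≤ d - j := by
    intro j hj
    induction j with
    | zero => exact (hp d le_rfl).1
    | succ j ih =>
      have := ih (by omega)
      have h6 := h3 (d - (j + 1)) (by omega)
      rw [show d - (j + 1) + 1 = d - j by omega] at h6
      omega
  obtain ⟨h6, h7, h8⟩ := h3 i i.2
  refine ⟨h6, Fin.ext ?_⟩
  have h9 := h4 i i.2.le
  have h10 := h5 (d - (i + 1)) (by omega)
  rw [show d - (d - ((i : ℕ) + 1)) = i + 1 by omega] at h10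
  rw [finProdFinEquiv_apply_val]
  simp only at h7 h8 ⊢
  rw [mul_comm d]
  have h11 : p i = i := by omega
  have h12 : p (i + 1) = i + 1 := by have := h4 (i + 1) i.2; omega
  rw [h11] at h7
  rw [h12] at h8
  simp only [Fin.eta] at h7 h8
  omega

/-- The permutation of the coordinates of the torus that permutes the blocks by `c`. -/
def blockPerm {N : ℕ} (d : ℕ) (c : Equiv.Perm (Fin N)) : Equiv.Perm (Fin (N * d)) :=
  finProdFinEquiv.permCongr (Equiv.prodCongrLeft fun _ : Fin d => c)

lemma blockPerm_apply {N d : ℕ} (c : Equiv.Perm (Fin N)) (l : Fin N) (i : Fin d) :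
    blockPerm d c (finProdFinEquiv (l, i)) = finProdFinEquiv (c l, i) := by
  simp [blockPerm, Equiv.permCongr_apply]

lemma sign_blockPerm {N d : ℕ} (c : Equiv.Perm (Fin N)) :
    Equiv.Perm.sign (blockPerm d c) = Equiv.Perm.sign c ^ d := by
  rw [blockPerm, Equiv.Perm.sign_permCongr, Equiv.Perm.sign_prodCongrLeft]
  simp

lemma pullback_blockMap_vertex {N d L : ℕ} [NeZero L] (hL : 3 ≤ L)
    (hre : d * (1 - (ZMod.toCircle (-1 : ZMod L) : ℂ).re) < 1 / 2) (c : Equiv.Perm (Fin N))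
    (l : Fin N) : pullback (blockMap d (c l)) (List.ofFn fun t : Fin (d + 1) =>
      gridMap (vertex (fun _ => (-1 : ZMod L)) (blockPerm d c) (l * d + t))) = 1 := by
  refine orient_eq_one fun s hs => ?_
  rw [List.getElem?_map, List.getElem?_ofFn]
  simp only [Nat.lt_succ_iff.2 hs, dif_pos, Option.map_some, Option.some.injEq]
  have hv : ∀ i : Fin d, gridMap (vertex (fun _ => (-1 : ZMod L)) (blockPerm d c) (l * d + s))
      (finProdFinEquiv (c l, i)) = ZMod.toCircle (if (i : ℕ) < s then 0 else -1 : ZMod L) := by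
    intro i
    have : (blockPerm d c).symm (finProdFinEquiv (c l, i)) = finProdFinEquiv (l, i) := by
      rw [Equiv.symm_apply_eq, blockPerm_apply]
    simp only [gridMap, vertex, this, finProdFinEquiv_apply_val, mul_comm d]
    congr 1
    split_ifs <;> first | omega | simp
  refine (label_torusMap_eq_iff hs _).2 ⟨?_, ?_, ?_⟩
  · simp only [ContinuousMap.coe_mk, hv]
    refine lt_of_le_of_lt ?_ hre
    have := Finset.sum_le_card_nsmul (Finset.univ : Finset (Fin d))
      (fun i => 1 - (ZMod.toCircle (if (i : ℕ) < s then 0 else -1 : ZMod L) : ℂ).re)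
      (1 - (ZMod.toCircle (-1 : ZMod L) : ℂ).re) ?_
    · simpa using this
    · intro i _
      split_ifs
      · have := (Complex.re_le_norm (ZMod.toCircle (-1 : ZMod L))).trans_eq (Circle.norm_coe _)
        simpa using this
      · rfl
  · intro i hi
    simp [hv, hi]
  · intro i hi
    simp only [ContinuousMap.coe_mk, hv, hi, lt_irrefl, if_false]
    exact toCircle_neg_one_im_neg hL

lemma torusSum_cups_eq_zero {N d L : ℕ} [NeZero L] (hd : 0 < d) (hL : 6 ≤ L) {c : Fin N → Fin N}
    (hc : ¬ Function.Injective c) : torusSum (gridMap (m := N * d) (L := L))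
      (cups d (List.ofFn fun l => pullback (blockMap d (c l)))) = 0 := by
  refine Finset.sum_eq_zero fun x _ => Finset.sum_eq_zero fun σ _ => mul_eq_zero_of_right _ ?_
  rw [cups_ofFn _ fun t => gridMap (vertex x σ t)]
  by_contra h
  rw [Finset.prod_eq_zero_iff] at h
  push Not at h
  refine hc fun l l' hl => ?_
  have h1 := (vertex_of_pullback_ne_zero hL (h l (Finset.mem_univ _)) ⟨0, hd⟩).2
  have h2 := (vertex_of_pullback_ne_zero hL (h l' (Finset.mem_univ _)) ⟨0, hd⟩).2
  rw [hl, h2] at h1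
  simpa using (finProdFinEquiv.injective h1).symm

lemma torusSum_cups_perm {N d L : ℕ} [NeZero L] (hL : 6 ≤ L)
    (hre : d * (1 - (ZMod.toCircle (-1 : ZMod L) : ℂ).re) < 1 / 2) (c : Equiv.Perm (Fin N)) :
    torusSum (gridMap (m := N * d) (L := L))
      (cups d (List.ofFn fun l => pullback (blockMap d (c l)))) = Equiv.Perm.sign c ^ d := by
  have key : ∀ (x : Fin (N * d) → ZMod L) (σ : Equiv.Perm (Fin (N * d))),
      cups d (List.ofFn fun l => pullback (blockMap d (c l)))
        (List.ofFn fun t : Fin (N * d + 1) => gridMap (vertex x σ t)) ≠ 0 →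
      x = (fun _ => -1) ∧ σ = blockPerm d c := by
    intro x σ h
    rw [cups_ofFn _ fun t => gridMap (vertex x σ t), Finset.prod_ne_zero_iff] at h
    have h1 := fun l i => vertex_of_pullback_ne_zero hL (h l (Finset.mem_univ _)) i
    constructor
    · funext a
      obtain ⟨⟨l, i⟩, rfl⟩ := finProdFinEquiv.surjective a
      simpa using (h1 (c.symm l) i).1
    · ext a
      obtain ⟨⟨l, i⟩, rfl⟩ := finProdFinEquiv.surjective a
      rw [blockPerm_apply, ← (h1 l i).2, Equiv.apply_symm_apply]
  rw [torusSum, Finset.sum_eq_single (fun _ => -1), Finset.sum_eq_single (blockPerm d c)]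
  · rw [cups_ofFn _ fun t => gridMap (vertex (fun _ => (-1 : ZMod L)) (blockPerm d c) t),
      Finset.prod_congr rfl fun l _ => pullback_blockMap_vertex (by omega) hre c l,
      sign_blockPerm]
    simp
  · intro σ _ hσ
    by_contra h
    exact hσ (key _ σ (right_ne_zero_of_mul h)).2
  · simp
  · intro x _ hx
    refine Finset.sum_eq_zero fun σ _ => ?_
    by_contra h
    exact hx (key x σ (right_ne_zero_of_mul h)).1
  · simp

lemma exists_grid (N d : ℕ) {ε : ℝ} (hε : 0 < ε) :
    ∃ (L : ℕ) (_ : NeZero L), 6 ≤ L ∧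
      d * (1 - (ZMod.toCircle (-1 : ZMod L) : ℂ).re) < 1 / 2 ∧
      ∀ (x : Fin (N * d) → ZMod L) (σ : Equiv.Perm (Fin (N * d))),
        Small ε (List.ofFn fun t : Fin (N * d + 1) => gridMap (vertex x σ t)) := by
  obtain ⟨L₀, h₀⟩ := exists_small_vertex (N * d) hε
  have hη : (0 : ℝ) < 1 / (2 * (d + 1)) := by positivity
  obtain ⟨L₁, h₁⟩ := exists_small_vertex 1 hη
  let L := L₀ + L₁ + 6
  have hne : NeZero L := ⟨by omega⟩
  refine ⟨L, hne, by omega, ?_, fun x σ => h₀ L (by omega) x σ⟩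
  have h := h₁ L (by omega) (fun _ => -1) 1 (gridMap fun _ => (-1 : ZMod L)) ?_
    (gridMap fun _ => (0 : ZMod L)) ?_
  · rw [dist_pi_lt_iff hη] at h
    have h := h 0
    simp only [gridMap, AddChar.map_zero_eq_one] at h
    rw [dist_comm] at h
    change dist ((1 : Circle) : ℂ) (ZMod.toCircle (-1 : ZMod L) : ℂ) < _ at h
    rw [Complex.dist_eq, Circle.coe_one] at h
    have h2 := (Complex.re_le_norm (1 - ZMod.toCircle (-1 : ZMod L))).trans_lt h
    rw [Complex.sub_re, Complex.one_re] at h2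
    rw [lt_div_iff₀ (by positivity)] at h2
    have h3 : (ZMod.toCircle (-1 : ZMod L) : ℂ).re ≤ 1 :=
      (Complex.re_le_norm (ZMod.toCircle (-1 : ZMod L))).trans_eq (Circle.norm_coe _)
    nlinarith
  · refine List.mem_ofFn.2 ⟨0, ?_⟩
    congr 1; funext a; simp [vertex]
  · refine List.mem_ofFn.2 ⟨1, ?_⟩
    congr 1; funext a; fin_cases a; simp [vertex]

/-- The evaluation on the fundamental class of the torus of a product of combinations of the
block classes, when this product vanishes for homotopical reasons. -/
lemma sum_perm_eq_zero {N d : ℕ} (hN : N ≠ 0) (hd : d ≠ 0)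
    (f g : Fin N → C(Fin (N * d) → Circle, Punctured d))
    (U : Fin N → Set (Fin (N * d) → Circle)) (hU : ∀ l, IsOpen (U l))
    (hcov : ⋃ l, U l = Set.univ)
    (hfg : ∀ l, ((f l).restrict (U l)).Homotopic ((g l).restrict (U l)))
    (A : Fin N → Fin N → ℤ)
    (hA : ∀ l l', l'.length = d + 1 → pullback (f l) l' - pullback (g l) l'
      = ∑ c, A l c * pullback (blockMap d c) l') :
    ∑ c : Equiv.Perm (Fin N), (∏ l, A l (c l)) * (Equiv.Perm.sign c : ℤ) ^ d = 0 := by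
  obtain ⟨p, rfl⟩ := Nat.exists_eq_succ_of_ne_zero hd
  obtain ⟨ε, hε, C, hC⟩ := exists_cups_eq_cobdry f g U hU hcov hfg
  obtain ⟨L, _, hL, hre, hsmall⟩ := exists_grid N (p + 1) hε
  have h0 : torusSum (gridMap (m := N * (p + 1)) (L := L)) (cobdry C) = 0 := by
    have : ∀ m, m ≠ 0 → ∀ C : List (Fin m → Circle) → ℤ,
        torusSum (gridMap (m := m) (L := L)) (cobdry C) = 0 := by
      intro m hm
      obtain ⟨m, rfl⟩ := Nat.exists_eq_succ_of_ne_zero hm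
      exact torusSum_cobdry _
    exact this _ (mul_ne_zero hN hd) C
  rw [← h0]
  have h1 : ∀ (x : Fin (N * (p + 1)) → ZMod L) (σ : Equiv.Perm (Fin (N * (p + 1)))),
      cobdry C (List.ofFn fun t : Fin (N * (p + 1) + 1) => gridMap (vertex x σ t))
        = ∑ c : Fin N → Fin N, (∏ l, A l (c l)) *
          cups (p + 1) (List.ofFn fun l => pullback (blockMap (p + 1) (c l)))
            (List.ofFn fun t : Fin (N * (p + 1) + 1) => gridMap (vertex x σ t)) := by
    intro x σ
    rw [← hC _ (hsmall x σ) (by simp), ← cups_ofFn_sum A (fun c => pullback (blockMap (p + 1) c))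
      fun t => gridMap (vertex x σ t), cups_ofFn _ fun t => gridMap (vertex x σ t),
      cups_ofFn _ fun t => gridMap (vertex x σ t)]
    exact Finset.prod_congr rfl fun l _ => hA l _ (by simp)
  have h2 : torusSum (gridMap (m := N * (p + 1)) (L := L)) (cobdry C)
      = ∑ c : Fin N → Fin N, (∏ l, A l (c l)) * torusSum (gridMap (m := N * (p + 1)) (L := L))
        (cups (p + 1) (List.ofFn fun l => pullback (blockMap (p + 1) (c l)))) := by
    simp only [torusSum, h1, Finset.mul_sum]
    conv_rhs => rw [Finset.sum_comm]
    refine Finset.sum_congr rfl fun x _ => ?_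
    conv_rhs => rw [Finset.sum_comm]
    refine Finset.sum_congr rfl fun σ _ => Finset.sum_congr rfl fun c _ => mul_left_comm _ _ _
  rw [h2]
  refine Fintype.sum_of_injective (fun c : Equiv.Perm (Fin N) => (c : Fin N → Fin N))
    DFunLike.coe_injective _ _ ?_ ?_
  · intro c hc
    rw [torusSum_cups_eq_zero p.succ_pos hL, mul_zero]
    intro hinj
    exact hc ⟨Equiv.ofBijective c (Finite.injective_iff_bijective.1 hinj), rfl⟩
  · intro c
    rw [torusSum_cups_perm hL hre]

lemma pullback_const {X : Type*} {d : ℕ} (hd : d ≠ 0) (w : Punctured d) (l : List X) :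
    pullback (fun _ => w) l = 0 := by
  by_contra h
  obtain ⟨i, -, hi⟩ := exists_getElem?_of_orient_ne_zero h (j := 0) (Nat.zero_le _)
  obtain ⟨i', -, hi'⟩ := exists_getElem?_of_orient_ne_zero h (j := 1) (Nat.one_le_iff_ne_zero.2 hd)
  rw [List.getElem?_map, Option.map_eq_some_iff] at hi hi'
  obtain ⟨_, _, h0⟩ := hi
  obtain ⟨_, _, h1⟩ := hi'
  exact zero_ne_one (h0.symm.trans h1)

/-- The torus of dimension `N * d` is not covered by `N` open sets on which the respective block
maps are nullhomotopic. -/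
theorem not_homotopic_const {N d : ℕ} (hN : N ≠ 0) (hd : d ≠ 0)
    (U : Fin N → Set (Fin (N * d) → Circle)) (hU : ∀ l, IsOpen (U l))
    (hcov : ⋃ l, U l = Set.univ) (w : Fin N → Punctured d)
    (h : ∀ l, ((blockMap d l).restrict (U l)).Homotopic
      ((ContinuousMap.const _ (w l)).restrict (U l))) : False := by
  have := sum_perm_eq_zero hN hd (blockMap d) (fun l => ContinuousMap.const _ (w l)) U hU hcov h
    (fun l c => if l = c then 1 else 0) fun l l' _ => by
      have := pullback_const hd (w l) l'
      change _ - pullback (fun _ => w l) l' = _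
      simp [this]
  rw [Finset.sum_eq_single 1] at this
  · simp at this
  · intro c _ hc
    refine mul_eq_zero_of_left (Finset.prod_eq_zero_iff.2 ?_) _
    by_contra! H
    refine hc (Equiv.ext fun l => ?_)
    have := H l (Finset.mem_univ _)
    rw [ne_eq, ite_eq_right_iff, Classical.not_imp] at this
    exact this.1.symm
  · simp

/-- For even `d`, if the block maps are arranged in pairs, then the torus is not covered by open
sets, one for each block map, on which the block maps in the respective pair are homotopic. -/
theorem not_homotopic_pairs {N d r : ℕ} (hN : N ≠ 0) (hd : d ≠ 0) (hdeven : Even d)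
    (e : Fin N ≃ Fin r × Bool)
    (U : Fin N → Set (Fin (N * d) → Circle)) (hU : ∀ l, IsOpen (U l))
    (hcov : ⋃ l, U l = Set.univ)
    (h : ∀ l j, ((blockMap d (e.symm (j, true))).restrict (U l)).Homotopic
      ((blockMap d (e.symm (j, false))).restrict (U l))) : False := by
  let s : Fin N → ℤ := fun c => if (e c).2 then 1 else -1
  have hs : ∀ c, s c * s c = 1 := fun c => by simp only [s]; split_ifs <;> norm_num
  have := sum_perm_eq_zero hN hd (fun l => blockMap d (e.symm ((e l).1, true)))
    (fun l => blockMap d (e.symm ((e l).1, false))) U hU hcov (fun l => h l _)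
    (fun l c => if (e l).1 = (e c).1 then s c else 0) fun l l' _ => by
      rw [← e.symm.sum_comp, Fintype.sum_prod_type]
      simp [s, Finset.sum_ite_eq, sub_eq_add_neg]
  have hsign : ∀ c : Equiv.Perm (Fin N), (Equiv.Perm.sign c : ℤ) ^ d = 1 := fun c => by
    rcases Int.units_eq_one_or (Equiv.Perm.sign c) with h | h <;> simp [h, hdeven.neg_one_pow]
  simp only [hsign, mul_one] at this
  set κ := ∏ l, s l with hκ
  have hκκ : κ * κ = 1 := by rw [hκ, ← Finset.prod_mul_distrib]; simp [hs]
  have hterm : ∀ c : Equiv.Perm (Fin N),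
      0 ≤ κ * ∏ l, (if (e l).1 = (e (c l)).1 then s (c l) else 0) := by
    intro c
    by_cases hc : ∀ l, (e l).1 = (e (c l)).1
    · rw [Finset.prod_congr rfl fun l _ => if_pos (hc l), Equiv.prod_comp c s, ← hκ, hκκ]
      exact zero_le_one
    · push Not at hc
      obtain ⟨l, hl⟩ := hc
      rw [Finset.prod_eq_zero (Finset.mem_univ l) (if_neg hl), mul_zero]
  have h1 := Finset.single_le_sum (fun c _ => hterm c) (Finset.mem_univ 1)
  rw [← Finset.mul_sum, this] at h1
  simp [← hκ, hκκ] at h1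

end ListCochain

/-- A continuous motion planner on a set of pairs of points. -/
def HasPlanner {X : Type*} [TopologicalSpace X] (U : Set (X × X)) : Prop :=
  ∃ s : C(↥U, C(unitInterval, X)),
    ∀ p : ↥U, (s p) 0 = (p : X × X).1 ∧ (s p) 1 = (p : X × X).2

lemma hasPlanner_empty {X : Type*} [TopologicalSpace X] : HasPlanner (∅ : Set (X × X)) :=
  ⟨⟨fun p => p.2.elim, continuous_iff_continuousAt.2 fun p => p.2.elim⟩, fun p => p.2.elim⟩

lemma tcCover_of_fintype {X ι : Type*} [TopologicalSpace X] [Fintype ι] (U : ι → Set (X × X))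
    (hU : ∀ i, IsOpen (U i)) (hcov : ∀ p, ∃ i, p ∈ U i) (h : ∀ i, HasPlanner (U i)) :
    TCCover X (Fintype.card ι) := by
  let e := (Fintype.equivFin ι).symm
  refine ⟨fun i => U (e i), fun i => hU _, Set.eq_univ_of_forall fun p => ?_, fun i => h _⟩
  obtain ⟨i, hi⟩ := hcov p
  exact Set.mem_iUnion.2 ⟨e.symm i, by simpa using hi⟩

lemma TCCover.mono {X : Type*} [TopologicalSpace X] {a b : ℕ} (hab : a ≤ b) (h : TCCover X a) :
    TCCover X b := by
  obtain ⟨c, rfl⟩ := Nat.exists_eq_add_of_le hab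
  obtain ⟨U, hU, hcov, hs⟩ := h
  have := tcCover_of_fintype (ι := Fin a ⊕ Fin c) (Sum.elim U fun _ => ∅) ?_ ?_ ?_
  · simpa using this
  · rintro (i | i)
    exacts [hU i, isOpen_empty]
  · intro p
    obtain ⟨i, hi⟩ := Set.mem_iUnion.1 (hcov.ge (Set.mem_univ p))
    exact ⟨Sum.inl i, hi⟩
  · rintro (i | i)
    exacts [hs i, hasPlanner_empty]

lemma TCCover.exists_homotopic {X T : Type*} [TopologicalSpace X] [TopologicalSpace T] {N : ℕ}
    (h : TCCover X N) (φ ψ : C(T, X)) :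
    ∃ U : Fin N → Set T, (∀ l, IsOpen (U l)) ∧ ⋃ l, U l = Set.univ ∧
      ∀ l, (φ.restrict (U l)).Homotopic (ψ.restrict (U l)) := by
  obtain ⟨V, hV, hcov, hs⟩ := h
  refine ⟨fun l => (fun y => (φ y, ψ y)) ⁻¹' V l, fun l => (hV l).preimage (by fun_prop), ?_,
    fun l => ?_⟩
  · rw [← Set.preimage_iUnion, hcov, Set.preimage_univ]
  · obtain ⟨s, hs⟩ := hs l
    exact ⟨⟨⟨fun z => s ⟨(φ z.2, ψ z.2), z.2.2⟩ z.1, by fun_prop⟩, fun y => (hs _).1,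
      fun y => (hs _).2⟩⟩

namespace ListCochain

lemma homotopic_of_inner_pos {T : Type*} [TopologicalSpace T] {d : ℕ} {f g : C(T, Punctured d)}
    (h : ∀ y, 0 < inner ℝ (f y : EuclideanSpace ℝ (Fin (d + 1))) (g y)) : f.Homotopic g := by
  refine ⟨⟨⟨fun z => ⟨(1 - (z.1 : ℝ)) • (f z.2 : EuclideanSpace ℝ (Fin (d + 1))) + (z.1 : ℝ) • g z.2,
    fun h0 => ?_⟩, by fun_prop⟩, fun y => by ext; simp, fun y => by ext; simp⟩⟩
  have h1 := congrArg (fun v => inner ℝ v (g z.2 : EuclideanSpace ℝ (Fin (d + 1)))) h0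
  simp only [inner_add_left, inner_smul_left, inner_zero_left, real_inner_self_eq_norm_sq] at h1
  simp only [conj_trivial] at h1
  have h2 := h z.2
  have h3 : 0 < ‖(g z.2 : EuclideanSpace ℝ (Fin (d + 1)))‖ ^ 2 :=
    pow_pos (norm_pos_iff.2 (g z.2).2) 2
  have h4 := z.1.2.1
  have h5 := z.1.2.2
  rcases h4.eq_or_lt with h4 | h4
  · rw [← h4] at h1; linarith
  · nlinarith [mul_pos h4 h3, mul_nonneg (sub_nonneg.2 h5) h2.le]

lemma Homotopic.restrict {X Y : Type*} [TopologicalSpace X] [TopologicalSpace Y] {f g : C(X, Y)}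
    (h : f.Homotopic g) (U : Set X) : (f.restrict U).Homotopic (g.restrict U) :=
  h.comp (ContinuousMap.Homotopic.refl (⟨Subtype.val, continuous_subtype_val⟩ : C(U, X)))

/-- The closed unit ball of `ℝ^(d + 1)`. -/
abbrev Ball (d : ℕ) : Type := ↥(Metric.closedBall (0 : EuclideanSpace ℝ (Fin (d + 1))) 1)

/-- The displacement from the point `a` to the point `b` of a configuration. -/
def displacement {d k : ℕ} {a b : Fin k} (hab : a ≠ b) : C(Conf (Ball d) k, Punctured d) where
  toFun x := ⟨(x.1 b : EuclideanSpace ℝ (Fin (d + 1))) - x.1 a, fun h =>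
    hab (x.2 (Subtype.ext (sub_eq_zero.1 h)).symm)⟩
  continuous_toFun := Continuous.subtype_mk
    ((continuous_subtype_val.comp ((continuous_apply b).comp continuous_subtype_val)).sub
      (continuous_subtype_val.comp ((continuous_apply a).comp continuous_subtype_val))) _

/-- The configuration of points at distinct distances from the origin in given directions. -/
noncomputable def radial {T : Type*} [TopologicalSpace T] {d k : ℕ} {ρ : Fin k → ℝ}
    (hρ : Function.Injective ρ) (hρ01 : ∀ j, ρ j ∈ Set.Icc (0 : ℝ) 1)
    (v : Fin k → C(T, Punctured d)) : C(T, Conf (Ball d) k) where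
  toFun y := ⟨fun j => ⟨(ρ j / ‖(v j y : EuclideanSpace ℝ (Fin (d + 1)))‖) • v j y, by
    rw [mem_closedBall_zero_iff, norm_smul, norm_div, norm_norm,
      div_mul_cancel₀ _ (norm_ne_zero_iff.2 (v j y).2), Real.norm_of_nonneg (hρ01 j).1]
    exact (hρ01 j).2⟩, fun i j hij => by
      have := congrArg (fun z : Ball d => ‖(z : EuclideanSpace ℝ (Fin (d + 1)))‖) hij
      simp only [norm_smul, norm_div, norm_norm] at this
      rw [div_mul_cancel₀ _ (norm_ne_zero_iff.2 (v i y).2),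
        div_mul_cancel₀ _ (norm_ne_zero_iff.2 (v j y).2), Real.norm_of_nonneg (hρ01 i).1,
        Real.norm_of_nonneg (hρ01 j).1] at this
      exact hρ this⟩
  continuous_toFun := by
    refine Continuous.subtype_mk (continuous_pi fun j => Continuous.subtype_mk ?_ _) _
    have : ∀ y, ‖(v j y : EuclideanSpace ℝ (Fin (d + 1)))‖ ≠ 0 := fun y =>
      norm_ne_zero_iff.2 (v j y).2
    fun_prop (disch := assumption)

section radial

variable {T : Type*} [TopologicalSpace T] {d k : ℕ} {ρ : Fin k → ℝ} (hρ : Function.Injective ρ)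
  (hρ01 : ∀ j, ρ j ∈ Set.Icc (0 : ℝ) 1) (v : Fin k → C(T, Punctured d)) {a b : Fin k}

lemma inner_radial (y : T) : ρ b * ‖(v b y : EuclideanSpace ℝ (Fin (d + 1)))‖
    = inner ℝ (((radial hρ hρ01 v y).1 b : Ball d) : EuclideanSpace ℝ (Fin (d + 1))) (v b y) := by
  change _ = inner ℝ ((ρ b / _) • _) _
  have := norm_ne_zero_iff.2 (v b y).2
  rw [inner_smul_left, real_inner_self_eq_norm_sq, conj_trivial]
  field_simp

lemma inner_radial_le (y : T) (w : EuclideanSpace ℝ (Fin (d + 1))) :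
    inner ℝ (((radial hρ hρ01 v y).1 b : Ball d) : EuclideanSpace ℝ (Fin (d + 1))) w
      ≤ ρ b * ‖w‖ := by
  refine (real_inner_le_norm _ _).trans_eq ?_
  change ‖(ρ b / _) • _‖ * _ = _
  rw [norm_smul, norm_div, norm_norm, div_mul_cancel₀ _ (norm_ne_zero_iff.2 (v b y).2),
    Real.norm_of_nonneg (hρ01 b).1]

lemma displacement_radial_homotopic (hab : a ≠ b) (h : ρ a < ρ b) :
    ((displacement hab).comp (radial hρ hρ01 v)).Homotopic (v b) := by
  refine homotopic_of_inner_pos fun y => ?_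
  change 0 < inner ℝ (_ - _) _
  have h1 := inner_radial_le hρ hρ01 v (b := a) y (v b y)
  rw [inner_sub_left, ← inner_radial, sub_pos]
  refine h1.trans_lt (mul_lt_mul_of_pos_right h (norm_pos_iff.2 (v b y).2))

lemma displacement_radial_homotopic_const (hab : a ≠ b) (h : ρ b < ρ a) (w w' : Punctured d)
    (hw : (w' : EuclideanSpace ℝ (Fin (d + 1))) = -w) (hv : v a = ContinuousMap.const _ w) :
    ((displacement hab).comp (radial hρ hρ01 v)).Homotopic (ContinuousMap.const _ w') := by
  refine homotopic_of_inner_pos fun y => ?_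
  change 0 < inner ℝ (_ - _) (w' : EuclideanSpace ℝ (Fin (d + 1)))
  have h1 := inner_radial_le hρ hρ01 v (b := b) y (-w')
  have h2 := inner_radial hρ hρ01 v (b := a) y
  rw [hv] at h2
  simp only [ContinuousMap.const_apply] at h2
  rw [hw] at h1 ⊢
  rw [inner_sub_left, inner_neg_right, inner_neg_right, ← h2]
  rw [neg_neg] at h1
  have h3 := mul_lt_mul_of_pos_right h (norm_pos_iff.2 w.2)
  linarith

end radial

/-- A point of the punctured space. -/
noncomputable def basepoint (d : ℕ) : Punctured d := ⟨EuclideanSpace.single 0 1, by simp⟩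

theorem not_tcCover_of_even {d r : ℕ} (hr : r ≠ 0) (hd : d ≠ 0) (hdeven : Even d) :
    ¬ TCCover (Conf (Ball d) (r + 1)) (r * 2) := by
  intro hTC
  let e : Fin (r * 2) ≃ Fin r × Bool := (Fintype.equivFinOfCardEq (by simp)).symm
  let ρ : Fin (r + 1) → ℝ := fun j => j / (r + 1)
  have hρ : StrictMono ρ := fun i j h =>
    div_lt_div_of_pos_right (Nat.cast_lt.2 h) (by positivity)
  have hρ01 : ∀ j, ρ j ∈ Set.Icc (0 : ℝ) 1 := fun j =>
    ⟨by positivity, (div_le_one (by positivity)).2 (by exact_mod_cast j.2.le)⟩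
  let v : Bool → Fin (r + 1) → C(Fin (r * 2 * d) → Circle, Punctured d) := fun s =>
    Fin.cons (ContinuousMap.const _ (basepoint d)) fun j => blockMap d (e.symm (j, s))
  obtain ⟨U, hU, hcov, hh⟩ := hTC.exists_homotopic (radial hρ.injective hρ01 (v true))
    (radial hρ.injective hρ01 (v false))
  refine not_homotopic_pairs (by omega) hd hdeven e U hU hcov fun l j => ?_
  have hj : (0 : Fin (r + 1)) < j.succ := Fin.succ_pos j
  have h1 := fun s => Homotopic.restrict
    (displacement_radial_homotopic hρ.injective hρ01 (v s) hj.ne (hρ hj)) (U l)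
  exact (h1 true).symm.trans (((ContinuousMap.Homotopic.refl (displacement hj.ne)).comp
    (hh l)).trans (h1 false))

theorem not_tcCover {d q : ℕ} (hd : d ≠ 0) :
    ¬ TCCover (Conf (Ball d) (q + 2)) (q + 1 + q) := by
  intro hTC
  let e : Fin (q + 1 + q) ≃ Fin (q + 1) ⊕ Fin q := finSumFinEquiv.symm
  let ρ : Fin (q + 2) → ℝ := fun j => j / (q + 2)
  have hρ : StrictMono ρ := fun i j h =>
    div_lt_div_of_pos_right (Nat.cast_lt.2 h) (by positivity)
  have hρ01 : ∀ j, ρ j ∈ Set.Icc (0 : ℝ) 1 := fun j =>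
    ⟨by positivity, (div_le_one (by positivity)).2 (by exact_mod_cast j.2.le)⟩
  have hρ1 : ∀ j, ρ j < 1 := fun j =>
    (div_lt_one (by positivity)).2 (by exact_mod_cast j.2)
  let ρ' : Fin (q + 2) → ℝ := Function.update ρ 1 1
  have hρ'ne : ∀ {j}, j ≠ 1 → ρ' j = ρ j := fun h => Function.update_of_ne h _ _
  have hρ'1 : ρ' 1 = 1 := Function.update_self _ _ _
  have hρ' : Function.Injective ρ' := by
    intro i j hij
    by_cases hi : i = 1 <;> by_cases hj : j = 1
    · rw [hi, hj]
    · rw [hi, hρ'1, hρ'ne hj] at hij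
      exact absurd hij (hρ1 j).ne'
    · rw [hj, hρ'1, hρ'ne hi] at hij
      exact absurd hij (hρ1 i).ne
    · rw [hρ'ne hi, hρ'ne hj] at hij
      exact hρ.injective hij
  have hρ'01 : ∀ j, ρ' j ∈ Set.Icc (0 : ℝ) 1 := by
    intro j
    by_cases hj : j = 1
    · rw [hj, hρ'1]; simp
    · rw [hρ'ne hj]; exact hρ01 j
  let T := Fin ((q + 1 + q) * d) → Circle
  let v : Fin (q + 2) → C(T, Punctured d) :=
    Fin.cons (ContinuousMap.const _ (basepoint d)) fun j => blockMap d (e.symm (Sum.inl j))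
  let v' : Fin (q + 2) → C(T, Punctured d) :=
    Fin.cons (ContinuousMap.const _ (basepoint d)) (Fin.cons (ContinuousMap.const _ (basepoint d))
      fun j => blockMap d (e.symm (Sum.inr j)))
  let w : Punctured d := ⟨-basepoint d, neg_ne_zero.2 (basepoint d).2⟩
  obtain ⟨U, hU, hcov, hh⟩ := hTC.exists_homotopic (radial hρ.injective hρ01 v)
    (radial hρ' hρ'01 v')
  have key : ∀ l (a b : Fin (q + 2)) (hab : a < b) (g : C(T, Punctured d)),
      ((displacement hab.ne).comp (radial hρ' hρ'01 v')).Homotopic g →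
      ((v b).restrict (U l)).Homotopic (g.restrict (U l)) := fun l a b hab g hg =>
    (Homotopic.restrict (displacement_radial_homotopic hρ.injective hρ01 v hab.ne (hρ hab))
      (U l)).symm.trans (((ContinuousMap.Homotopic.refl (displacement hab.ne)).comp
        (hh l)).trans (Homotopic.restrict hg (U l)))
  have hlt : ∀ j : Fin q, (1 : Fin (q + 2)) < j.succ.succ := fun j => by
    rw [Fin.lt_def]; simp
  have hleft : ∀ l (j : Fin q), ((v j.succ.succ).restrict (U l)).Homotopic
      ((ContinuousMap.const T w).restrict (U l)) := fun l j =>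
    key l 1 j.succ.succ (hlt j) _ (displacement_radial_homotopic_const hρ' hρ'01 v' (hlt j).ne
      (by rw [hρ'1, hρ'ne (hlt j).ne']; exact hρ1 _) (basepoint d) w rfl rfl)
  have hnull : ∀ l c, ∃ w : Punctured d, ((blockMap d c).restrict (U l)).Homotopic
      ((ContinuousMap.const T w).restrict (U l)) := by
    intro l c
    obtain ⟨c, rfl⟩ := e.symm.surjective c
    rcases c with j | j
    · induction j using Fin.cases with
      | zero =>
        refine ⟨basepoint d, key l 0 1 (by simp) _ ?_⟩
        exact displacement_radial_homotopic hρ' hρ'01 v' (by simp)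
          (by rw [hρ'1, hρ'ne (by simp)]; exact hρ1 _)
      | succ j => exact ⟨w, hleft l j⟩
    · refine ⟨w, (key l 0 j.succ.succ (Fin.succ_pos _) _ ?_).symm.trans (hleft l j)⟩
      refine displacement_radial_homotopic hρ' hρ'01 v' _ ?_
      rw [hρ'ne (hlt j).ne', hρ'ne (by simp)]
      exact hρ (Fin.succ_pos _)
  choose W hW using fun l => hnull l l
  exact not_homotopic_const (by omega) hd U hU hcov W hW

end ListCochain

open scoped NNReal

lemma hasPlanner_iff_homotopic {X : Type*} [TopologicalSpace X] {U : Set (X × X)} :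
    HasPlanner U ↔ ((ContinuousMap.fst (α := X) (β := X)).restrict U).Homotopic
      (ContinuousMap.snd.restrict U) := by
  constructor
  · rintro ⟨s, hs⟩
    exact ⟨⟨⟨fun z => s z.2 z.1, by fun_prop⟩, fun p => (hs p).1, fun p => (hs p).2⟩⟩
  · rintro ⟨F⟩
    exact ⟨(F.toContinuousMap.comp ⟨Prod.swap, continuous_swap⟩).curry, fun p =>
      ⟨F.map_zero_left p, F.map_one_left p⟩⟩

lemma HasPlanner.mono {X : Type*} [TopologicalSpace X] {U V : Set (X × X)} (hUV : U ⊆ V)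
    (h : HasPlanner V) : HasPlanner U := by
  obtain ⟨s, hs⟩ := h
  exact ⟨s.comp ⟨Set.inclusion hUV, continuous_inclusion hUV⟩, fun p => hs _⟩

lemma hasPlanner_iUnion {X ι : Type*} [TopologicalSpace X] (U : ι → Set (X × X))
    (hU : ∀ i, IsOpen (U i)) (hdisj : ∀ i j p, p ∈ U i → p ∈ U j → i = j)
    (h : ∀ i, HasPlanner (U i)) : HasPlanner (⋃ i, U i) := by
  choose s hs using h
  let S : ι → Set ↥(⋃ i, U i) := fun i => Subtype.val ⁻¹' U i
  let φ : ∀ i, C(S i, C(unitInterval, X)) := fun i =>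
    (s i).comp ⟨fun p => ⟨p.1, p.2⟩, by fun_prop⟩
  have hφ : ∀ i j (x : ↥(⋃ i, U i)) (hxi : x ∈ S i) (hxj : x ∈ S j), φ i ⟨x, hxi⟩ = φ j ⟨x, hxj⟩ := by
    intro i j x hxi hxj
    obtain rfl := hdisj i j x hxi hxj
    rfl
  have hS : ∀ x : ↥(⋃ i, U i), ∃ i, S i ∈ 𝓝 x := fun x => by
    obtain ⟨i, hi⟩ := Set.mem_iUnion.1 x.2
    exact ⟨i, ((hU i).preimage continuous_subtype_val).mem_nhds hi⟩
  refine ⟨ContinuousMap.liftCover S φ hφ hS, fun p => ?_⟩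
  obtain ⟨i, hi⟩ := Set.mem_iUnion.1 p.2
  have : ContinuousMap.liftCover S φ hφ hS p = φ i ⟨p, hi⟩ :=
    ContinuousMap.liftCover_coe (S := S) (φ := φ) (hφ := hφ) (hS := hS) ⟨p, hi⟩
  rw [this]
  exact hs i _

/-- A motion planning cover from finitely many decreasing filtrations of `X × X` by open sets,
with motion planners near the intersections of their strata. -/
theorem tcCover_of_filtrations {X ι : Type*} [TopologicalSpace X] [Fintype ι]
    (α : ι → ℕ → X × X → ℝ≥0) (hα : ∀ r i, Continuous (α r i))
    (hanti : ∀ r p, Antitone fun i => α r i p) (lo hi : ι → ℕ)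
    (hlo : ∀ r p, 0 < α r (lo r) p) (hhi : ∀ r p, α r (hi r + 1) p = 0)
    (O : (ι → ℕ) → Set (X × X)) (hO : ∀ I, IsOpen (O I)) (hplan : ∀ I, HasPlanner (O I))
    (hmem : ∀ I p, (∀ r, 0 < α r (I r) p ∧ α r (I r + 1) p = 0) → p ∈ O I) :
    TCCover X (∑ r, hi r + 1 - ∑ r, lo r) := by
  let W : (ι → ℕ) → Set (X × X) := fun I =>
    O I ∩ ⋂ r, ⋂ r', {p | α r' (I r' + 1) p < α r (I r) p}
  have hW : ∀ I, IsOpen (W I) := fun I => (hO I).inter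
    (isOpen_iInter_of_finite fun r => isOpen_iInter_of_finite fun r' =>
      isOpen_lt (hα _ _) (hα _ _))
  have hWlt : ∀ {I p}, p ∈ W I → ∀ r r', α r' (I r' + 1) p < α r (I r) p := fun h r r' => by
    simpa using Set.mem_iInter.1 (Set.mem_iInter.1 h.2 r) r'
  have hex : ∀ p, ∃ I, p ∈ W I ∧ ∀ r, lo r ≤ I r ∧ I r ≤ hi r := by
    intro p
    have : ∀ r, ∃ i, (0 < α r i p ∧ α r (i + 1) p = 0) ∧ lo r ≤ i ∧ i ≤ hi r := by
      intro r
      classical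
      have hex : ∃ i, α r (i + 1) p = 0 := ⟨_, hhi r p⟩
      have hz : ∀ {i j}, i ≤ j → α r i p = 0 → α r j p = 0 := fun hij h0 =>
        nonpos_iff_eq_zero.1 ((hanti r p hij).trans h0.le)
      have h1 : lo r ≤ Nat.find hex := by
        by_contra! h
        exact (hlo r p).ne' (hz h (Nat.find_spec hex))
      refine ⟨Nat.find hex, ⟨?_, Nat.find_spec hex⟩, h1, Nat.find_min' hex (hhi r p)⟩
      rcases h1.eq_or_lt with h1 | h1
      · rw [← h1]; exact hlo r p
      · obtain ⟨j, hj⟩ : ∃ j, Nat.find hex = j + 1 := ⟨Nat.find hex - 1, by omega⟩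
        have := Nat.find_min hex (m := j) (by omega)
        rw [hj]
        exact pos_iff_ne_zero.2 this
    choose I hI hI' using this
    refine ⟨I, ⟨hmem I p hI, ?_⟩, hI'⟩
    simp only [Set.mem_iInter]
    intro r r'
    change α r' (I r' + 1) p < α r (I r) p
    rw [(hI r').2]
    exact (hI r).1
  let U : Fin (∑ r, hi r + 1 - ∑ r, lo r) → Set (X × X) := fun l =>
    ⋃ I : {I : ι → ℕ // ∑ r, I r = l + ∑ r, lo r}, W I
  have := tcCover_of_fintype U (fun l => isOpen_iUnion fun I => hW _) ?_ ?_
  · simpa using this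
  · intro p
    obtain ⟨I, hI, hI'⟩ := hex p
    have h1 : ∑ r, lo r ≤ ∑ r, I r := Finset.sum_le_sum fun r _ => (hI' r).1
    have h2 : ∑ r, I r ≤ ∑ r, hi r := Finset.sum_le_sum fun r _ => (hI' r).2
    exact ⟨⟨∑ r, I r - ∑ r, lo r, by omega⟩, Set.mem_iUnion.2 ⟨⟨I, by simp only; omega⟩, hI⟩⟩
  · intro l
    refine hasPlanner_iUnion _ (fun I => hW _) ?_ fun I =>
      (hplan I.1).mono Set.inter_subset_left
    rintro ⟨I, hI⟩ ⟨I', hI'⟩ p hp hp'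
    simp only at hp hp'
    have key : ∀ {I I' : ι → ℕ}, ∑ r, I r = ∑ r, I' r → I ≠ I' → ∃ r, I r < I' r := by
      intro I I' hs hne
      by_contra! H
      refine hne (funext fun r => ?_)
      exact ((Finset.sum_eq_sum_iff_of_le fun r _ => H r).1 hs.symm r (Finset.mem_univ r)).symm
    by_contra hne
    have hne : I ≠ I' := fun h => hne (Subtype.ext h)
    obtain ⟨r, hr⟩ := key (hI.trans hI'.symm) hne
    obtain ⟨r', hr'⟩ := key (hI'.trans hI.symm) hne.symm
    exact lt_irrefl _ (calc
      α r (I r + 1) p < α r' (I r') p := hWlt hp _ _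
      _ ≤ α r' (I' r' + 1) p := hanti r' p hr'
      _ < α r (I' r) p := hWlt hp' _ _
      _ ≤ α r (I r + 1) p := hanti r p hr)

/-- The complexity of a space is bounded by that of a space that dominates it. -/
lemma TCCover.of_homotopic_id {X Y : Type*} [TopologicalSpace X] [TopologicalSpace Y] {m : ℕ}
    (h : TCCover Y m) (i : C(X, Y)) (r : C(Y, X))
    (hri : (r.comp i).Homotopic (ContinuousMap.id X)) : TCCover X m := by
  obtain ⟨V, hV, hcov, hs⟩ := h
  have := tcCover_of_fintype (fun l => Prod.map i i ⁻¹' V l)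
    (fun l => (hV l).preimage (by fun_prop)) (fun p => by
      simpa using Set.mem_iUnion.1 (hcov.ge (Set.mem_univ (Prod.map i i p))))
    fun l => hasPlanner_iff_homotopic.2 ?_
  · simpa using this
  · have h1 := hasPlanner_iff_homotopic.1 (hs l)
    let q : C(Prod.map i i ⁻¹' V l, V l) := ⟨fun p => ⟨Prod.map i i p, p.2⟩, by fun_prop⟩
    have h2 : ∀ f : C(Prod.map i i ⁻¹' V l, X), f.Homotopic ((r.comp i).comp f) := fun f =>
      (hri.symm.comp (ContinuousMap.Homotopic.refl f))
    exact (h2 (ContinuousMap.fst.restrict _)).trans ((((ContinuousMap.Homotopic.refl r).comp h1).comp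
      (ContinuousMap.Homotopic.refl q)).trans
        (h2 (ContinuousMap.snd.restrict _)).symm)

/-- Configurations in the unit ball retract from configurations in the whole space. -/
lemma tcCover_conf_closedBall {E : Type*} [NormedAddCommGroup E] [NormedSpace ℝ E] {k m : ℕ}
    (h : TCCover (Conf E k) m) : TCCover (Conf (↥(Metric.closedBall (0 : E) 1)) k) m := by
  have hpos : ∀ (t : unitInterval) (x : E), 0 < 1 + (t : ℝ) * ‖x‖ := fun t x => by
    have := mul_nonneg t.2.1 (norm_nonneg x)
    linarith
  have hinj : ∀ (t : unitInterval) (x y : E),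
      (1 + (t : ℝ) * ‖x‖)⁻¹ • x = (1 + (t : ℝ) * ‖y‖)⁻¹ • y → x = y := by
    intro t x y hxy
    have hx := hpos t x
    have hy := hpos t y
    have h1 : ‖x‖ = ‖y‖ := by
      have := congrArg norm hxy
      rw [norm_smul, norm_smul, norm_inv, norm_inv, Real.norm_of_nonneg hx.le,
        Real.norm_of_nonneg hy.le] at this
      field_simp at this
      linarith
    rw [h1] at hxy
    exact smul_right_injective E (inv_ne_zero hy.ne') hxy
  have hnorm : ∀ (t : unitInterval) (x : E), ‖x‖ ≤ 1 ∨ t = 1 →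
      (1 + (t : ℝ) * ‖x‖)⁻¹ • x ∈ Metric.closedBall (0 : E) 1 := by
    intro t x hx
    rw [mem_closedBall_zero_iff, norm_smul, norm_inv, Real.norm_of_nonneg (hpos t x).le,
      inv_mul_le_one₀ (hpos t x)]
    rcases hx with hx | rfl
    · have := mul_nonneg t.2.1 (norm_nonneg x)
      linarith
    · simp
  have hcont : ∀ {T : Type _} [TopologicalSpace T] (t : T → unitInterval) (x : T → E),
      Continuous t → Continuous x →
      Continuous fun y => (1 + (t y : ℝ) * ‖x y‖)⁻¹ • x y := by
    intro T _ t x ht hx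
    exact (Continuous.inv₀ (by fun_prop) fun y => (hpos _ _).ne').smul hx
  let i : C(Conf (↥(Metric.closedBall (0 : E) 1)) k, Conf E k) :=
    ⟨fun c => ⟨fun a => c.1 a, Subtype.val_injective.comp c.2⟩,
      Continuous.subtype_mk (continuous_pi fun a => continuous_subtype_val.comp
        ((continuous_apply a).comp continuous_subtype_val)) _⟩
  let r : C(Conf E k, Conf (↥(Metric.closedBall (0 : E) 1)) k) :=
    ⟨fun c => ⟨fun a => ⟨_, hnorm 1 (c.1 a) (Or.inr rfl)⟩, fun a b hab =>
      c.2 (hinj _ _ _ (congrArg Subtype.val hab))⟩,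
      Continuous.subtype_mk (continuous_pi fun a => Continuous.subtype_mk
        (hcont _ _ continuous_const ((continuous_apply a).comp continuous_subtype_val)) _) _⟩
  let B := ↥(Metric.closedBall (0 : E) 1)
  let H : unitInterval × Conf B k → Conf B k := fun z =>
    ⟨fun a => ⟨_, hnorm z.1 (z.2.1 a) (Or.inl (mem_closedBall_zero_iff.1 (z.2.1 a).2))⟩,
      fun a b hab => z.2.2 (Subtype.ext (hinj _ _ _ (congrArg Subtype.val hab)))⟩
  have hH : Continuous H :=
    Continuous.subtype_mk (continuous_pi fun a => Continuous.subtype_mk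
      (hcont (fun z : unitInterval × Conf B k => z.1) (fun z => (z.2.1 a : E)) continuous_fst
        (continuous_subtype_val.comp ((continuous_apply a).comp
          (continuous_subtype_val.comp continuous_snd)))) _) _
  refine h.of_homotopic_id i r ⟨ContinuousMap.Homotopy.symm ⟨⟨H, hH⟩, fun c => ?_, fun c => rfl⟩⟩
  ext a
  simp [H]

namespace ConfPlanner

lemma continuous_apply_conf {E : Type*} [TopologicalSpace E] {k : ℕ}
    (a : Fin k) : Continuous fun x : Conf E k => x.1 a :=
  (continuous_apply a).comp continuous_subtype_val

variable {E : Type*} [NormedAddCommGroup E] [InnerProductSpace ℝ E] {k : ℕ}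

lemma homotopic_of_segment {T : Type*} [TopologicalSpace T] {f g : C(T, Conf E k)}
    (h : ∀ y (t : unitInterval) a b, a ≠ b →
      (1 - (t : ℝ)) • ((f y).1 a - (f y).1 b) + (t : ℝ) • ((g y).1 a - (g y).1 b) ≠ 0) :
    f.Homotopic g := by
  refine ⟨⟨⟨fun z => ⟨fun a => (1 - (z.1 : ℝ)) • (f z.2).1 a + (z.1 : ℝ) • (g z.2).1 a,
    fun a b hab => ?_⟩, Continuous.subtype_mk (continuous_pi fun a => ?_) _⟩, fun y => ?_,
    fun y => ?_⟩⟩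
  · by_contra hne
    refine h z.2 z.1 a b hne ?_
    rw [smul_sub, smul_sub, sub_add_sub_comm, sub_eq_zero]
    exact hab
  · have hf : Continuous fun z : unitInterval × T => (f z.2).1 a :=
      (continuous_apply a).comp (continuous_subtype_val.comp (f.continuous.comp continuous_snd))
    have hg : Continuous fun z : unitInterval × T => (g z.2).1 a :=
      (continuous_apply a).comp (continuous_subtype_val.comp (g.continuous.comp continuous_snd))
    have ht : Continuous fun z : unitInterval × T => (z.1 : ℝ) :=
      continuous_subtype_val.comp continuous_fst
    exact ((continuous_const.sub ht).smul hf).add (ht.smul hg)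
  · ext; simp
  · ext; simp

/-- The height of a point of a configuration in the direction `e`. -/
noncomputable def height (e : C(Conf E k, E)) (x : Conf E k) (a : Fin k) : ℝ :=
  inner ℝ (x.1 a) (e x)

lemma continuous_height (e : C(Conf E k, E)) (a : Fin k) : Continuous fun x => height e x a :=
  (continuous_apply_conf a).inner e.continuous

/-- A function that is positive exactly when the points have at least `i` distinct heights. -/
noncomputable def spread (e : C(Conf E k, E)) (i : ℕ) (x : Conf E k) : ℝ≥0 :=
  (Finset.powersetCard i Finset.univ).sup fun S : Finset (Fin k) =>
    ∏ q ∈ S.offDiag, min 1 (nndist (height e x q.1) (height e x q.2))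

lemma continuous_spread (e : C(Conf E k, E)) (i : ℕ) : Continuous (spread e i) :=
  Continuous.finset_sup_apply fun _ _ => continuous_finsetProd _ fun _ _ =>
    continuous_const.min ((continuous_height e _).nndist (continuous_height e _))

lemma prod_offDiag_le_of_subset (e : C(Conf E k, E)) (x : Conf E k) {S S' : Finset (Fin k × Fin k)}
    (h : S' ⊆ S) : ∏ q ∈ S, min 1 (nndist (height e x q.1) (height e x q.2))
      ≤ ∏ q ∈ S', min 1 (nndist (height e x q.1) (height e x q.2)) :=
  Finset.prod_le_prod_of_subset_of_le_one' h fun _ _ _ => min_le_left _ _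

lemma antitone_spread (e : C(Conf E k, E)) (x : Conf E k) : Antitone fun i => spread e i x := by
  refine antitone_nat_of_succ_le fun i => Finset.sup_le fun S hS => ?_
  obtain ⟨S', hS', hcard⟩ := Finset.exists_subset_card_eq
    (show i ≤ S.card by rw [(Finset.mem_powersetCard.1 hS).2]; omega)
  exact (prod_offDiag_le_of_subset e x (Finset.offDiag_mono hS')).trans
    (Finset.le_sup (f := fun S : Finset (Fin k) =>
      ∏ q ∈ S.offDiag, min 1 (nndist (height e x q.1) (height e x q.2)))
      (Finset.mem_powersetCard.2 ⟨Finset.subset_univ _, hcard⟩))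

lemma spread_eq_zero (e : C(Conf E k, E)) (x : Conf E k) : spread e (k + 1) x = 0 := by
  rw [spread, Finset.powersetCard_eq_empty.2 (by simp), Finset.sup_empty]
  rfl

lemma spread_pos (e : C(Conf E k, E)) (x : Conf E k) (S : Finset (Fin k))
    (hS : Set.InjOn (height e x) S) : 0 < spread e S.card x := by
  refine lt_of_lt_of_le ?_ (Finset.le_sup (f := fun S : Finset (Fin k) =>
      ∏ q ∈ S.offDiag, min 1 (nndist (height e x q.1) (height e x q.2)))
      (Finset.mem_powersetCard.2 ⟨Finset.subset_univ S, rfl⟩))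
  refine Finset.prod_pos fun q hq => lt_min one_pos ?_
  rw [Finset.mem_offDiag] at hq
  exact pos_iff_ne_zero.2 fun h => hq.2.2 (hS hq.1 hq.2.1 (nndist_eq_zero.1 h))

lemma spread_le_nndist (e : C(Conf E k, E)) {x : Conf E k} {i : ℕ} (h : 0 < spread e i x)
    (h' : spread e (i + 1) x = 0) {a b : Fin k} (hab : height e x a ≠ height e x b) :
    spread e i x ≤ nndist (height e x a) (height e x b) := by
  classical
  obtain ⟨S, hS, hSmax⟩ := Finset.exists_mem_eq_sup (Finset.powersetCard i Finset.univ) (by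
    by_contra hne
    rw [Finset.not_nonempty_iff_eq_empty] at hne
    rw [spread, hne, Finset.sup_empty] at h
    exact lt_irrefl _ h) fun S : Finset (Fin k) =>
    ∏ q ∈ S.offDiag, min 1 (nndist (height e x q.1) (height e x q.2))
  change spread e i x = _ at hSmax
  rw [hSmax] at h ⊢
  have hcard := (Finset.mem_powersetCard.1 hS).2
  have hex : ∀ c, ∃ s ∈ S, height e x s = height e x c := by
    intro c
    by_cases hc : c ∈ S
    · exact ⟨c, hc, rfl⟩
    have h1 := Finset.le_sup (f := fun S : Finset (Fin k) =>
      ∏ q ∈ S.offDiag, min 1 (nndist (height e x q.1) (height e x q.2)))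
      (Finset.mem_powersetCard.2 ⟨Finset.subset_univ (insert c S), rfl⟩)
    rw [Finset.card_insert_of_notMem hc, hcard] at h1
    have h2 := nonpos_iff_eq_zero.1 (h1.trans h'.le)
    obtain ⟨⟨p, q⟩, hpq, h3⟩ := Finset.prod_eq_zero_iff.1 h2
    rw [Finset.mem_offDiag] at hpq
    obtain ⟨hp, hq, hne⟩ : p ∈ insert c S ∧ q ∈ insert c S ∧ p ≠ q := hpq
    have h4 : height e x p = height e x q := by
      rcases min_choice (1 : ℝ≥0) (nndist (height e x p) (height e x q)) with h5 | h5
      · simp only [h5] at h3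
        exact absurd h3 one_ne_zero
      · simp only [h5] at h3
        exact nndist_eq_zero.1 h3
    rcases Finset.mem_insert.1 hp with hp' | hp' <;> rcases Finset.mem_insert.1 hq with hq' | hq'
    · exact absurd (hp'.trans hq'.symm) hne
    · exact ⟨q, hq', h4.symm.trans (congrArg _ hp')⟩
    · exact ⟨p, hp', h4.trans (congrArg _ hq')⟩
    · refine absurd (Finset.prod_eq_zero (Finset.mem_offDiag.2 ⟨hp', hq', hne⟩) h3) h.ne'
  obtain ⟨s, hs, hsa⟩ := hex a
  obtain ⟨t, ht, htb⟩ := hex b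
  rw [← hsa, ← htb] at hab ⊢
  refine (prod_offDiag_le_of_subset e x (Finset.singleton_subset_iff.2
    (show (s, t) ∈ S.offDiag from Finset.mem_offDiag.2
      ⟨hs, ht, fun h => hab (congrArg (height e x) h)⟩))).trans ?_
  rw [Finset.prod_singleton]
  exact min_le_right _ _

/-- The configurations which can be moved in the direction `e`, proportionally to the index, to
configurations of points of distinct heights. -/
def liftable (e : C(Conf E k, E)) (i : ℕ) : Set (Conf E k) :=
  {x | ∀ a b : Fin k, a ≠ b →
    (x.1 a - x.1 b - (height e x a - height e x b) • e x ≠ 0 ∨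
      |((a : ℝ) - b) / k * spread e i x| < |height e x a - height e x b|) ∧
    height e x a - height e x b + ((a : ℝ) - b) / k * spread e i x ≠ 0}

lemma isOpen_liftable (e : C(Conf E k, E)) (i : ℕ) : IsOpen (liftable e i) := by
  have h1 := fun a => continuous_height e a
  have h2 := continuous_spread e i
  have h3 : ∀ a : Fin k, Continuous fun x : Conf E k => x.1 a := continuous_apply_conf
  have h4 : Continuous fun x => (spread e i x : ℝ) := NNReal.continuous_coe.comp h2
  have : liftable e i = ⋂ a : Fin k, ⋂ b : Fin k, ⋂ _ : a ≠ b,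
      ({x | x.1 a - x.1 b - (height e x a - height e x b) • e x ≠ 0} ∪
        {x | |((a : ℝ) - b) / k * spread e i x| < |height e x a - height e x b|}) ∩
      {x | height e x a - height e x b + ((a : ℝ) - b) / k * spread e i x ≠ 0} := by
    ext x; simp [liftable]
  rw [this]
  refine isOpen_iInter_of_finite fun a => isOpen_iInter_of_finite fun b =>
    isOpen_iInter_of_finite fun _ => IsOpen.inter (IsOpen.union ?_ ?_) ?_
  · refine isOpen_ne_fun ?_ continuous_const
    exact ((h3 a).sub (h3 b)).sub (((h1 a).sub (h1 b)).smul e.continuous)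
  · exact isOpen_lt (continuous_const.mul h4).abs ((h1 a).sub (h1 b)).abs
  · exact isOpen_ne_fun (((h1 a).sub (h1 b)).add (continuous_const.mul h4)) continuous_const

lemma mem_liftable (e : C(Conf E k, E)) {x : Conf E k} {i : ℕ} (h : 0 < spread e i x)
    (h' : spread e (i + 1) x = 0) : x ∈ liftable e i := by
  intro a b hab
  have hk : (0 : ℝ) < k := by
    have := a.pos
    exact_mod_cast this
  have hab' : (a : ℝ) - b ≠ 0 := by
    rw [sub_ne_zero]
    exact_mod_cast fun h => hab (Fin.ext h)
  have hg : (0 : ℝ) < spread e i x := by exact_mod_cast h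
  by_cases hh : height e x a = height e x b
  · rw [hh, sub_self, zero_smul, sub_zero, zero_add]
    exact ⟨Or.inl (sub_ne_zero.2 fun h => hab (x.2 h)),
      mul_ne_zero (div_ne_zero hab' hk.ne') hg.ne'⟩
  · have h1 : (spread e i x : ℝ) ≤ |height e x a - height e x b| := by
      rw [← Real.dist_eq]
      exact_mod_cast spread_le_nndist e h h' hh
    have h2 : |((a : ℝ) - b) / k * spread e i x| < |height e x a - height e x b| := by
      refine lt_of_lt_of_le ?_ h1
      rw [abs_mul, abs_of_pos hg]
      refine mul_lt_of_lt_one_left hg ?_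
      rw [abs_div, abs_of_pos hk, div_lt_one hk, abs_lt]
      have ha : (a : ℝ) < k := by exact_mod_cast a.2
      have hb : (b : ℝ) < k := by exact_mod_cast b.2
      have ha' : (0 : ℝ) ≤ a := by positivity
      have hb' : (0 : ℝ) ≤ b := by positivity
      constructor <;> linarith
    refine ⟨Or.inr h2, fun h3 => ?_⟩
    rw [eq_neg_of_add_eq_zero_left h3, abs_neg] at h2
    exact lt_irrefl _ h2

/-- Equally spaced configurations on a line through the origin. -/
def column : C({v : E // v ≠ 0}, Conf E k) where
  toFun v := ⟨fun a => (a : ℝ) • (v : E), fun a b h =>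
    Fin.ext (by exact_mod_cast smul_left_injective ℝ v.2 h)⟩
  continuous_toFun := by
    refine Continuous.subtype_mk (continuous_pi fun a => ?_) _
    fun_prop

lemma homotopic_column {T : Type*} [TopologicalSpace T] {e : C(Conf E k, E)}
    (he : ∀ x, ‖e x‖ = 1) {f : C(Conf E k, {v : E // v ≠ 0})}
    (hef : ∀ x, inner ℝ (f x : E) (e x) = 0) {i : ℕ} (φ : C(T, Conf E k))
    (hφ : ∀ y, φ y ∈ liftable e i) : φ.Homotopic (column.comp (f.comp φ)) := by
  have hee : ∀ x, inner ℝ (e x) (e x) = 1 := fun x => by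
    rw [real_inner_self_eq_norm_sq, he, one_pow]
  have h1 := fun a => continuous_height e a
  have h4 : Continuous fun x => (spread e i x : ℝ) :=
    NNReal.continuous_coe.comp (continuous_spread e i)
  let ψ₀ : Conf E k → Fin k → E := fun x a => x.1 a + ((a : ℝ) / k * spread e i x) • e x
  have hinner : ∀ x a b, inner ℝ (ψ₀ x a - ψ₀ x b) (e x)
      = height e x a - height e x b + ((a : ℝ) - b) / k * spread e i x := by
    intro x a b
    simp only [ψ₀, inner_sub_left, inner_add_left, inner_smul_left, hee, height, conj_trivial]
    ring
  have hψ₀ : ∀ x ∈ liftable e i, Function.Injective (ψ₀ x) := by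
    intro x hx a b hab
    by_contra hne
    refine (hx a b hne).2 ?_
    rw [← hinner, hab, sub_self, inner_zero_left]
  let ψ : C(T, Conf E k) := ⟨fun y => ⟨ψ₀ (φ y), hψ₀ _ (hφ y)⟩,
    Continuous.subtype_mk (continuous_pi fun a => by
      have h5 : Continuous fun x => ψ₀ x a :=
        (continuous_apply_conf a).add ((continuous_const.mul h4).smul e.continuous)
      exact h5.comp φ.continuous) _⟩
  have hφψ : φ.Homotopic ψ := by
    refine homotopic_of_segment fun y t a b hab h0 => ?_
    obtain ⟨h5, -⟩ := hφ y a b hab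
    set c : ℝ := ((a : ℝ) - b) / k * spread e i (φ y) with hc
    have h6 : (φ y).1 a - (φ y).1 b + ((t : ℝ) * c) • e (φ y) = 0 := by
      rw [← h0]
      change _ = (1 - (t : ℝ)) • ((φ y).1 a - (φ y).1 b)
        + (t : ℝ) • ((φ y).1 a + ((a : ℝ) / k * spread e i (φ y)) • e (φ y)
          - ((φ y).1 b + ((b : ℝ) / k * spread e i (φ y)) • e (φ y)))
      rw [hc]
      module
    have h7 : height e (φ y) a - height e (φ y) b + t * c = 0 := by
      have := congrArg (fun v => inner ℝ v (e (φ y))) h6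
      simpa only [height, inner_add_left, inner_sub_left, inner_smul_left, hee, conj_trivial, mul_one,
        inner_zero_left] using this
    rcases h5 with h5 | h5
    · refine h5 ?_
      rw [eq_neg_of_add_eq_zero_left h7, neg_smul, sub_neg_eq_add, h6]
    · rw [eq_neg_of_add_eq_zero_left h7, abs_neg, abs_mul (t : ℝ) c, abs_of_nonneg t.2.1] at h5
      exact absurd h5 (not_lt.2 (mul_le_of_le_one_left (abs_nonneg _) t.2.2))
  refine hφψ.trans (homotopic_of_segment fun y t a b hab h0 => ?_)
  change (1 - (t : ℝ)) • (ψ₀ (φ y) a - ψ₀ (φ y) b)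
    + (t : ℝ) • ((a : ℝ) • (f (φ y) : E) - (b : ℝ) • (f (φ y) : E)) = 0 at h0
  have h5 := congrArg (fun v => inner ℝ v (e (φ y))) h0
  simp only [inner_add_left, inner_smul_left, hinner, inner_sub_left (𝕜 := ℝ) (_ • _), hef,
    conj_trivial, mul_zero, sub_zero, add_zero, inner_zero_left] at h5
  have h6 := (mul_eq_zero.1 h5).resolve_right (hφ y a b hab).2
  rw [h6, zero_smul, zero_add, ← sub_smul, show (t : ℝ) = 1 by linarith, one_smul,
    smul_eq_zero, sub_eq_zero] at h0
  rcases h0 with h0 | h0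
  · exact hab (Fin.ext (by exact_mod_cast h0))
  · exact (f (φ y)).2 h0

/-- A motion planning cover of a configuration space from an orthogonal frame depending on the
configuration and a filtration that controls the second vector of the frame. -/
theorem tcCover_of_frame {e : C(Conf E k, E)} (he : ∀ x, ‖e x‖ = 1)
    {f : C(Conf E k, {v : E // v ≠ 0})} (hef : ∀ x, inner ℝ (f x : E) (e x) = 0) {lo : ℕ}
    (hlo : ∀ x, 0 < spread e lo x) (β : ℕ → Conf E k × Conf E k → ℝ≥0)
    (hβ : ∀ s, Continuous (β s)) (hβanti : ∀ p, Antitone fun s => β s p)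
    (hβ0 : ∀ p, 0 < β 0 p) {m : ℕ} (hβm : ∀ p, β (m + 1) p = 0)
    (V : ℕ → Set (Conf E k × Conf E k)) (hV : ∀ s, IsOpen (V s))
    (hVmem : ∀ s p, 0 < β s p → β (s + 1) p = 0 → p ∈ V s)
    (hVf : ∀ s, ((f.comp ContinuousMap.fst).restrict (V s)).Homotopic
      ((f.comp ContinuousMap.snd).restrict (V s))) :
    TCCover (Conf E k) (k + k + m + 1 - (lo + lo)) := by
  have := tcCover_of_filtrations (X := Conf E k) (ι := Fin 3)
    ![fun i p => spread e i p.1, fun i p => spread e i p.2, β]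
    (by
      intro r i
      fin_cases r
      exacts [(continuous_spread e i).comp continuous_fst,
        (continuous_spread e i).comp continuous_snd, hβ i])
    (by
      intro r p
      fin_cases r
      exacts [antitone_spread e p.1, antitone_spread e p.2, hβanti p])
    ![lo, lo, 0] ![k, k, m]
    (by
      intro r p
      fin_cases r
      exacts [hlo _, hlo _, hβ0 p])
    (by
      intro r p
      fin_cases r
      exacts [spread_eq_zero e _, spread_eq_zero e _, hβm p])
    (fun I => (Prod.fst ⁻¹' liftable e (I 0) ∩ Prod.snd ⁻¹' liftable e (I 1)) ∩ V (I 2))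
    (fun I => (((isOpen_liftable e _).preimage continuous_fst).inter
      ((isOpen_liftable e _).preimage continuous_snd)).inter (hV _))
    (fun I => by
      refine hasPlanner_iff_homotopic.2 ?_
      set O := (Prod.fst ⁻¹' liftable e (I 0) ∩ Prod.snd ⁻¹' liftable e (I 1)) ∩ V (I 2)
      let ι : C(O, V (I 2)) := ⟨Set.inclusion Set.inter_subset_right, continuous_inclusion _⟩
      exact (homotopic_column he hef (ContinuousMap.fst.restrict O) fun y => y.2.1.1).trans
        (((ContinuousMap.Homotopic.refl column).comp ((hVf (I 2)).comp
          (ContinuousMap.Homotopic.refl ι))).trans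
          (homotopic_column he hef (ContinuousMap.snd.restrict O) fun y => y.2.1.2).symm))
    (fun I p h => ⟨⟨mem_liftable e (h 0).1 (h 0).2, mem_liftable e (h 1).1 (h 1).2⟩,
      hVmem _ _ (h 2).1 (h 2).2⟩)
  simpa [Fin.sum_univ_three] using this

end ConfPlanner

lemma homotopic_of_ne_neg {E T : Type*} [NormedAddCommGroup E] [NormedSpace ℝ E]
    [TopologicalSpace T] {f g : C(T, {v : E // v ≠ 0})} (h : ∀ y, ‖(f y : E)‖ = ‖(g y : E)‖)
    (hne : ∀ y, (f y : E) ≠ -g y) : f.Homotopic g := by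
  refine ⟨⟨⟨fun z => ⟨(1 - (z.1 : ℝ)) • (f z.2 : E) + (z.1 : ℝ) • (g z.2 : E), fun h0 => ?_⟩,
    Continuous.subtype_mk ?_ _⟩, fun y => ?_, fun y => ?_⟩⟩
  · obtain ⟨t, y⟩ := z
    simp only at h0
    have h1 := eq_neg_of_add_eq_zero_left h0
    have h2 := congrArg norm h1
    rw [norm_neg, norm_smul, norm_smul, h, Real.norm_of_nonneg (sub_nonneg.2 t.2.2),
      Real.norm_of_nonneg t.2.1] at h2
    have h3 := mul_right_cancel₀ (norm_ne_zero_iff.2 (g y).2) h2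
    rw [h3, ← smul_neg] at h1
    exact hne y (smul_right_injective E (show (t : ℝ) ≠ 0 by intro h4; linarith) h1)
  · have hf : Continuous fun z : unitInterval × T => (f z.2 : E) :=
      continuous_subtype_val.comp (f.continuous.comp continuous_snd)
    have hg : Continuous fun z : unitInterval × T => (g z.2 : E) :=
      continuous_subtype_val.comp (g.continuous.comp continuous_snd)
    have ht : Continuous fun z : unitInterval × T => (z.1 : ℝ) :=
      continuous_subtype_val.comp continuous_fst
    exact ((continuous_const.sub ht).smul hf).add (ht.smul hg)
  · ext; simp
  · ext; simp

namespace ConfPlanner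

variable {E : Type*} [NormedAddCommGroup E] [InnerProductSpace ℝ E] {k : ℕ}

theorem tcCover_of_orthogonal {u v : E} (hu : ‖u‖ = 1) (hv : v ≠ 0) (huv : inner ℝ v u = 0)
    (hk : 1 ≤ k) : TCCover (Conf E k) (2 * k - 1) := by
  have h := tcCover_of_frame (k := k) (e := ContinuousMap.const _ u) (fun _ => hu)
    (f := ContinuousMap.const _ ⟨v, hv⟩) (fun _ => huv) (lo := 1)
    (fun x => spread_pos _ x {⟨0, hk⟩} (by simp))
    (fun s _ => if s = 0 then 1 else 0) (fun _ => continuous_const)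
    (fun _ => antitone_nat_of_succ_le fun s => by simp) (fun _ => by simp) (m := 0)
    (fun _ => by simp) (fun _ => Set.univ) (fun _ => isOpen_univ)
    (fun _ _ _ _ => Set.mem_univ _) (fun _ => ContinuousMap.Homotopic.refl _)
  convert h using 1
  omega

/-- The direction from the first point of a configuration to the second one. -/
noncomputable def direction (a b : Fin k) (hab : b ≠ a) : C(Conf E k, E) where
  toFun x := ‖x.1 b - x.1 a‖⁻¹ • (x.1 b - x.1 a)
  continuous_toFun := by
    have h := (continuous_apply_conf (E := E) b).sub (continuous_apply_conf a)
    exact (h.norm.inv₀ fun x => norm_ne_zero_iff.2 (sub_ne_zero.2 fun h => hab (x.2 h))).smul h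

lemma norm_direction {a b : Fin k} (hab : b ≠ a) (x : Conf E k) : ‖direction a b hab x‖ = 1 :=
  norm_smul_inv_norm (𝕜 := ℝ) (sub_ne_zero.2 fun h => hab (x.2 h))

lemma height_direction_ne {a b : Fin k} (hab : b ≠ a) (x : Conf E k) :
    height (direction a b hab) x b ≠ height (direction a b hab) x a := by
  have h : x.1 b - x.1 a ≠ 0 := sub_ne_zero.2 fun h => hab (x.2 h)
  rw [← sub_ne_zero, height, height, ← inner_sub_left]
  change inner ℝ (x.1 b - x.1 a) (‖x.1 b - x.1 a‖⁻¹ • (x.1 b - x.1 a)) ≠ 0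
  rw [inner_smul_right]
  exact mul_ne_zero (inv_ne_zero (norm_ne_zero_iff.2 h)) (inner_self_ne_zero.2 h)

theorem tcCover_of_rotation (J : E →ₗᵢ[ℝ] E) (hJ : ∀ v, inner ℝ (J v) v = 0) (hk : 2 ≤ k) :
    TCCover (Conf E k) (2 * k - 2) := by
  classical
  let a : Fin k := ⟨0, by omega⟩
  let b : Fin k := ⟨1, by omega⟩
  have hab : b ≠ a := by simp [a, b]
  let e : C(Conf E k, E) := direction a b hab
  have he : ∀ x, ‖e x‖ = 1 := norm_direction hab
  have he0 : ∀ x, e x ≠ 0 := fun x => norm_ne_zero_iff.1 ((he x).trans_ne one_ne_zero)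
  have hJe : ∀ x, ‖J (e x)‖ = 1 := fun x => (J.norm_map _).trans (he x)
  have hJe0 : ∀ x, J (e x) ≠ 0 := fun x => norm_ne_zero_iff.1 ((hJe x).trans_ne one_ne_zero)
  let f : C(Conf E k, {v : E // v ≠ 0}) :=
    ⟨fun x => ⟨J (e x), hJe0 x⟩, (J.continuous.comp e.continuous).subtype_mk _⟩
  let f' : C(Conf E k, {v : E // v ≠ 0}) :=
    ⟨fun x => ⟨-J (e x), neg_ne_zero.2 (hJe0 x)⟩, (J.continuous.comp e.continuous).neg.subtype_mk _⟩
  let g : C(Conf E k, {v : E // v ≠ 0}) := ⟨fun x => ⟨e x, he0 x⟩, e.continuous.subtype_mk _⟩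
  have hJne : ∀ x, J (e x) ≠ -e x := fun x h => by
    have := hJ (e x)
    rw [h, inner_neg_left, neg_eq_zero] at this
    exact he0 x (inner_self_eq_zero.1 this)
  have hff' : f.Homotopic f' :=
    (homotopic_of_ne_neg (g := g) (fun x => (hJe x).trans (he x).symm) hJne).trans
      (homotopic_of_ne_neg (fun x => (he x).trans ((norm_neg _).trans (hJe x)).symm) fun x h =>
        hJne x (by
          change e x = - -J (e x) at h
          have := hJ (e x)
          rw [neg_neg] at h
          rw [← h] at this
          exact absurd (inner_self_eq_zero.1 this) (he0 x)))
  let V : ℕ → Set (Conf E k × Conf E k) := fun s =>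
    if s = 0 then {p | e p.1 ≠ e p.2} else {p | e p.1 ≠ -e p.2}
  have hV0 : ∀ s, s = 0 → V s = {p | e p.1 ≠ e p.2} := fun s hs => if_pos hs
  have hV1 : ∀ s, s ≠ 0 → V s = {p | e p.1 ≠ -e p.2} := fun s hs => if_neg hs
  have hc1 := e.continuous.comp (continuous_fst (X := Conf E k) (Y := Conf E k))
  have hc2 := e.continuous.comp (continuous_snd (X := Conf E k) (Y := Conf E k))
  have hcard : ({b, a} : Finset (Fin k)).card = 2 := Finset.card_pair hab
  have h := tcCover_of_frame he (f := f) (fun x => hJ (e x)) (lo := 2)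
    (fun x => by
      rw [← hcard]
      refine spread_pos e x _ ?_
      rw [Finset.coe_pair, Set.injOn_pair]
      exact fun h => absurd h (height_direction_ne hab x))
    (fun s p => if s = 0 then 2 else if s = 1 then ‖e p.1 + e p.2‖₊ else 0)
    (fun s => by
      split_ifs
      exacts [continuous_const, (hc1.add hc2).nnnorm, continuous_const])
    (fun p => antitone_nat_of_succ_le fun s => by
      rcases s with _ | s
      · have : ‖e p.1 + e p.2‖₊ ≤ 1 + 1 :=
          (norm_add_le _ _).trans (add_le_add (he _).le (he _).le)
        rw [one_add_one_eq_two] at this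
        simpa using this
      · simp)
    (fun _ => by simp) (m := 1) (fun _ => by simp) V
    (fun s => by
      by_cases hs : s = 0
      · exact hV0 s hs ▸ isOpen_ne_fun hc1 hc2
      · exact hV1 s hs ▸ isOpen_ne_fun hc1 hc2.neg)
    (fun s p h1 h2 => by
      rcases s with _ | _ | s
      · simp only [zero_add, one_ne_zero, if_false, if_true, nnnorm_eq_zero] at h2
        intro h3
        rw [← h3, ← two_smul ℝ, smul_eq_zero] at h2
        exact h2.elim two_ne_zero (he0 _)
      · simp only [zero_add, one_ne_zero, if_false, if_true] at h1
        intro h3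
        rw [h3, neg_add_cancel, nnnorm_zero] at h1
        exact lt_irrefl _ h1
      · simp at h1)
    (fun s => by
      by_cases hs : s = 0
      · have hVs : ∀ p ∈ V s, e p.1 ≠ e p.2 := fun p hp => (hV0 s hs).subset hp
        refine (hff'.comp (ContinuousMap.Homotopic.refl
          (ContinuousMap.fst.restrict (V s)))).trans (homotopic_of_ne_neg (fun y => ?_) ?_)
        · exact (norm_neg _).trans ((hJe _).trans (hJe _).symm)
        · intro y h3
          exact hVs y.1 y.2 (J.injective (neg_injective h3))
      · have hVs : ∀ p ∈ V s, e p.1 ≠ -e p.2 := fun p hp => (hV1 s hs).subset hp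
        refine homotopic_of_ne_neg (fun y => (hJe _).trans (hJe _).symm) ?_
        intro y h3
        refine hVs y.1 y.2 (J.injective ?_)
        rw [map_neg]
        exact h3)
  convert h using 1
  omega

end ConfPlanner

/-- In even dimension there is an isometry that turns every vector by a right angle. -/
lemma exists_linearIsometry_inner_eq_zero {n : ℕ} (hn : Even n) :
    ∃ J : EuclideanSpace ℝ (Fin n) →ₗᵢ[ℝ] EuclideanSpace ℝ (Fin n), ∀ v, inner ℝ (J v) v = 0 := by
  obtain ⟨m, rfl⟩ := hn
  let ε : Fin (m + m) → ℝ := fun i => if (i : ℕ) < m then 1 else -1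
  have hε : ∀ i, ε i.rev = -ε i := by
    intro i
    by_cases hi : (i : ℕ) < m
    · rw [show ε i = 1 from if_pos hi, show ε i.rev = -1 from if_neg (by rw [Fin.val_rev]; omega)]
    · rw [show ε i = -1 from if_neg hi, show ε i.rev = 1 from if_pos (by rw [Fin.val_rev]; omega),
        neg_neg]
  have hε2 : ∀ i, |ε i| = 1 := by
    intro i
    simp only [ε]
    split_ifs <;> simp
  refine ⟨⟨⟨⟨fun v => WithLp.toLp 2 fun i => ε i * v i.rev, fun v w => ?_⟩, fun c v => ?_⟩,
    fun v => ?_⟩, fun v => ?_⟩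
  · ext i; simp [mul_add]
  · ext i; simp [mul_left_comm]
  · rw [EuclideanSpace.norm_eq, EuclideanSpace.norm_eq, ← Equiv.sum_comp Fin.revPerm
      fun i => ‖v i‖ ^ 2]
    simp [hε2]
  · have h : ∑ i, ε i * v i.rev * v i = ∑ i, -(ε i * v i.rev * v i) := by
      rw [← Equiv.sum_comp Fin.revPerm]
      refine Finset.sum_congr rfl fun i _ => ?_
      rw [Fin.revPerm_apply, hε, Fin.rev_rev]
      ring
    rw [Finset.sum_neg_distrib, self_eq_neg] at h
    rw [← h, PiLp.inner_apply]
    refine Finset.sum_congr rfl fun i _ => ?_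
    simp [mul_comm]

theorem topologicalComplexity_eq {X : Type*} [TopologicalSpace X] {m : ℕ} (h : TCCover X (m + 1))
    (h' : ¬ TCCover X m) : TopologicalComplexity X = (m + 1 : ℕ) := by
  refine le_antisymm (sInf_le ⟨m + 1, rfl, h⟩) (le_sInf ?_)
  rintro _ ⟨c, rfl, hc⟩
  by_contra hlt
  exact h' (hc.mono (by rw [not_le, Nat.cast_lt] at hlt; omega))

/-- For `n, k ≥ 2`, `TC(F(𝔻^n, k)) = 2k − 1` for `n` odd and `2k − 2` for `n`
even. -/
theorem stmt5 (n k : ℕ) (hn : 2 ≤ n) (hk : 2 ≤ k) :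
    TopologicalComplexity (Conf (↥(Metric.closedBall (0 : EuclideanSpace ℝ (Fin n)) 1)) k)
      = if Odd n then ((2 * k - 1 : ℕ) : ℕ∞) else ((2 * k - 2 : ℕ) : ℕ∞) := by
  obtain ⟨d, rfl⟩ : ∃ d, n = d + 1 := ⟨n - 1, by omega⟩
  obtain ⟨q, rfl⟩ : ∃ q, k = q + 2 := ⟨k - 2, by omega⟩
  have hd : d ≠ 0 := by omega
  split_ifs with hodd
  · have hdeven : Even d := by
      rw [Nat.odd_add_one, Nat.not_odd_iff_even] at hodd
      exact hodd
    rw [show 2 * (q + 2) - 1 = (q + 1) * 2 + 1 by omega]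
    refine topologicalComplexity_eq (tcCover_conf_closedBall ?_)
      (ListCochain.not_tcCover_of_even (r := q + 1) (by omega) hd hdeven)
    rw [show (q + 1) * 2 + 1 = 2 * (q + 2) - 1 by omega]
    refine ConfPlanner.tcCover_of_orthogonal
      (u := EuclideanSpace.single (⟨0, by omega⟩ : Fin (d + 1)) (1 : ℝ))
      (v := EuclideanSpace.single (⟨1, by omega⟩ : Fin (d + 1)) (1 : ℝ)) (by simp) ?_ ?_ (by omega)
    · rw [← norm_ne_zero_iff]
      simp
    · simp [EuclideanSpace.inner_single_left]
  · obtain ⟨J, hJ⟩ := exists_linearIsometry_inner_eq_zero (Nat.not_odd_iff_even.1 hodd)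
    rw [show 2 * (q + 2) - 2 = q + 1 + q + 1 by omega]
    refine topologicalComplexity_eq (tcCover_conf_closedBall ?_) (ListCochain.not_tcCover hd)
    rw [show q + 1 + q + 1 = 2 * (q + 2) - 2 by omega]
    exact ConfPlanner.tcCover_of_rotation J hJ (by omega)
end

section
/- Let M be a nonempty connected compact topological n-dimensional manifold with nonempty boundary, where n = dim(M). Then for every integer k ≥ 1 the inclusion map i_k(M) : F(M,k) → M^k is (n−1)-connected: the induced homomorphism on homotopy groups π_q(F(M,k)) → π_q(M^k) is surjective for q = n−1 and is an isomorphism (respectively, a bijection of pointed sets for q = 0) for all 0 ≤ q ≤ n−2, for any choice of basepoint in F(M,k). -/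
open scoped Topology

/-- Interior of a topological manifold with boundary: the set of points having
an open neighborhood homeomorphic to `ℝ^n`. -/
def mfdInterior (n : ℕ) (M : Type*) [TopologicalSpace M] : Set M :=
  {x | ∃ U : Set M, IsOpen U ∧ x ∈ U ∧ Nonempty (U ≃ₜ EuclideanSpace ℝ (Fin n))}

/-- The inclusion `i_k(X) : F(X,k) → X^k` of the configuration space into the
product. -/
def confToPi (X : Type*) [TopologicalSpace X] (k : ℕ) : C(Conf X k, Fin k → X) :=
  ⟨fun f => f.1, continuous_subtype_val⟩

/-- The map of generalized loops induced by postcomposition with a continuous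
map. -/
def GenLoop.induced {N : Type*} {X Y : Type*} [TopologicalSpace X] [TopologicalSpace Y]
    (f : C(X, Y)) {x : X} (p : GenLoop N X x) : GenLoop N Y (f x) :=
  ⟨f.comp p.1, fun y hy => by
    simp only [ContinuousMap.comp_apply]
    exact congrArg f (p.2 y hy)⟩

/-- The map `f_* : π_q(X, x) → π_q(Y, f x)` of homotopy groups induced by a
continuous map `f`. -/
def HomotopyGroup.induced {N : Type*} {X Y : Type*} [TopologicalSpace X] [TopologicalSpace Y]
    (f : C(X, Y)) (x : X) :
    HomotopyGroup N X x → HomotopyGroup N Y (f x) :=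
  Quotient.map (GenLoop.induced f)
    (fun _ _ h => h.map fun F => F.compContinuousMap f)

open Set Function Module in
/-- General position: a continuous map `g` from a closed subset of a compact space of dimension
less than `n` to `ℝⁿ` can be made nowhere zero by adding an arbitrarily small vector field, which
may be chosen to point into the upper half-space. -/
theorem exists_small_add_ne_zero {n : ℕ} [NeZero n] {T E : Type*} [TopologicalSpace T]
    [CompactSpace T] [NormedAddCommGroup E] [NormedSpace ℝ E] [FiniteDimensional ℝ E]
    {e : T → E} (he : Topology.IsClosedEmbedding e) (hE : finrank ℝ E < n) {L : Set T} (hL : IsClosed L)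
    {g : T → EuclideanSpace ℝ (Fin n)} (hg : ContinuousOn g L) {ε : ℝ} (hε : 0 < ε) :
    ∃ w : C(T, EuclideanSpace ℝ (Fin n)), ‖w‖ < ε ∧ (∀ t, 0 ≤ w t 0) ∧
      ∀ t ∈ L, g t + w t ≠ 0 := by
  have heL : Topology.IsClosedEmbedding (fun t : L => e t) := he.comp hL.isClosedEmbedding_subtypeVal
  obtain ⟨G, hG⟩ := ContinuousMap.exists_extension' heL ⟨L.domRestrict g, hg.domRestrict⟩
  have hδ : 0 < ε / 5 := by positivity
  obtain ⟨s, hs, hsG, -⟩ := G.continuous.exists_contDiff_approx (ε := fun _ => ε / 5) 1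
    continuous_const (fun _ => hδ)
  have hdense : Dense (range s)ᶜ :=
    hs.dense_compl_range_of_finrank_lt_finrank (by simpa using hE)
  set b : EuclideanSpace ℝ (Fin n) := EuclideanSpace.single 0 (-(2 * (ε / 5))) with hb
  obtain ⟨c, hc, hcb⟩ := hdense.exists_dist_lt b hδ
  rw [dist_eq_norm] at hcb
  have hbn : ‖b‖ = 2 * (ε / 5) := by
    rw [hb, PiLp.norm_single, norm_neg, Real.norm_of_nonneg (by positivity)]
  have hcn : ‖c‖ ≤ 3 * (ε / 5) := by
    have : ‖c‖ ≤ ‖b‖ + ‖b - c‖ := by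
      have := norm_sub_le b (b - c)
      simpa using this
    linarith
  have hc0 : c 0 ≤ -(ε / 5) := by
    have h1 : ‖(b - c) 0‖ ≤ ‖b - c‖ := PiLp.norm_apply_le _ _
    have h2 : (b - c) 0 = -(2 * (ε / 5)) - c 0 := by simp [hb]
    rw [h2, Real.norm_eq_abs, abs_le] at h1
    linarith [h1.1]
  refine ⟨⟨fun t => s (e t) - G (e t) - c, ?_⟩, ?_, fun t => ?_, fun t ht h0 => ?_⟩
  · have := hs.continuous
    have := he.continuous
    fun_prop
  · refine (ContinuousMap.norm_le _ (by positivity : 0 ≤ 4 * (ε / 5))).2 (fun t => ?_)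
      |>.trans_lt (by linarith)
    have h1 := hsG (e t)
    rw [dist_eq_norm] at h1
    exact (norm_sub_le _ _).trans (by linarith)
  · have h1 := hsG (e t)
    rw [dist_eq_norm] at h1
    have h2 : ‖(s (e t) - G (e t)) 0‖ ≤ ‖s (e t) - G (e t)‖ := PiLp.norm_apply_le _ _
    rw [Real.norm_eq_abs, abs_le] at h2
    have h3 : (s (e t) - G (e t) - c) 0 = (s (e t) - G (e t)) 0 - c 0 := by simp
    simp only [ContinuousMap.coe_mk]
    rw [h3]
    linarith [h2.1]
  · have h1 : G (e t) = g t := congrFun hG ⟨t, ht⟩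
    simp only [ContinuousMap.coe_mk, h1] at h0
    refine hc ⟨e t, ?_⟩
    rw [← sub_eq_zero, ← h0]
    abel

open Set in
/-- Around a point of a manifold with boundary, a chart composed with the inclusion of the half-space
into `ℝⁿ` has a one-sided inverse defined and continuous on an open subset of `ℝⁿ`. -/
theorem exists_coordinates_halfSpace {n : ℕ} [NeZero n] {M : Type*} [TopologicalSpace M]
    [ChartedSpace (EuclideanHalfSpace n) M] (x : M) :
    ∃ (φ : M → EuclideanSpace ℝ (Fin n)) (ψ : EuclideanSpace ℝ (Fin n) → M)
      (V : Set (EuclideanSpace ℝ (Fin n))), IsOpen V ∧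
      ContinuousOn φ (chartAt (EuclideanHalfSpace n) x).source ∧
      MapsTo φ (chartAt (EuclideanHalfSpace n) x).source V ∧ ContinuousOn ψ V ∧
      LeftInvOn ψ φ (chartAt (EuclideanHalfSpace n) x).source ∧ (∀ y, 0 ≤ φ y 0) ∧
      ∀ z ∈ V, 0 ≤ z 0 → φ (ψ z) = z := by
  set c := chartAt (EuclideanHalfSpace n) x
  set I := modelWithCornersEuclideanHalfSpace n
  refine ⟨fun y => I (c y), fun z => c.symm (I.symm z), I.symm ⁻¹' c.target,
    c.open_target.preimage I.continuous_symm, I.continuous.comp_continuousOn c.continuousOn,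
    fun y hy => ?_, c.continuousOn_symm.comp I.continuous_symm.continuousOn fun _ hz => hz,
    fun y hy => ?_, fun y => (c y).2, fun z hz hz0 => ?_⟩
  · rw [mem_preimage, I.left_inv]
    exact c.map_source hy
  · simp only [I.left_inv]
    exact c.left_inv hy
  · simp only [c.right_inv hz]
    exact I.right_inv ⟨⟨z, hz0⟩, rfl⟩

open Set Function Module in
/-- If the coordinates `i ≠ j` of a map `h : T → M^k` from a compact space of dimension less than
`dim M` take values in a common chart over an open set `U`, then `h` can be deformed by an
arbitrarily small homotopy supported in `U` such that these coordinates become different on a given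
closed subset of `U`. -/
theorem exists_homotopicRel_ne_of_chart {n : ℕ} [NeZero n] {M T E ι : Type*} [TopologicalSpace M]
    [ChartedSpace (EuclideanHalfSpace n) M] [DecidableEq ι] [TopologicalSpace T]
    [CompactSpace T] [T2Space T] [NormedAddCommGroup E] [NormedSpace ℝ E] [FiniteDimensional ℝ E]
    {e : T → E} (he : Topology.IsClosedEmbedding e) (hE : finrank ℝ E < n) {L U : Set T}
    (hL : IsClosed L) (hU : IsOpen U) (hLU : L ⊆ U) (h : C(T, ι → M)) {i j : ι} (hij : i ≠ j)
    (x : M) (hi : ∀ t ∈ U, h t i ∈ (chartAt (EuclideanHalfSpace n) x).source)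
    (hj : ∀ t ∈ U, h t j ∈ (chartAt (EuclideanHalfSpace n) x).source)
    {N : Set C(T, ι → M)} (hN : N ∈ 𝓝 h) :
    ∃ h' ∈ N, h.HomotopicRel h' Uᶜ ∧ ∀ t ∈ L, h' t i ≠ h' t j := by
  obtain ⟨l, hlU, hlL, hl01⟩ :=
    exists_tsupport_one_of_isOpen_isClosed hU isClosed_closure.isCompact hL hLU
  obtain ⟨φ, ψ, V, hV, hφ, hφV, hψ, hleft, hφ0, hright⟩ :=
    exists_coordinates_halfSpace (n := n) x
  have hcj : Continuous fun t => h t j := (continuous_apply j).comp h.continuous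
  have hci : Continuous fun t => h t i := (continuous_apply i).comp h.continuous
  have hφj : ContinuousOn (fun t => φ (h t j)) U :=
    hφ.comp hcj.continuousOn hj
  have hφi : ContinuousOn (fun t => φ (h t i)) U :=
    hφ.comp hci.continuousOn hi
  obtain ⟨ε, hε, hεV⟩ : ∃ ε, 0 < ε ∧
      Metric.thickening ε ((fun t => φ (h t j)) '' tsupport l) ⊆ V := by
    refine IsCompact.exists_thickening_subset_open
      ((isClosed_tsupport _).isCompact.image_of_continuousOn (hφj.mono hlU)) hV ?_
    rintro _ ⟨t, ht, rfl⟩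
    exact hφV (hj t (hlU ht))
  let B := Metric.ball (0 : C(T, EuclideanSpace ℝ (Fin n))) ε
  have hmemV : ∀ w ∈ B, ∀ t ∈ U, φ (h t j) + l t • w t ∈ V := by
    intro w hw t ht
    by_cases hlt : t ∈ tsupport l
    · refine hεV (Metric.mem_thickening_iff.2 ⟨_, ⟨t, hlt, rfl⟩, ?_⟩)
      rw [dist_eq_norm, add_sub_cancel_left, norm_smul, Real.norm_of_nonneg (hl01 t).1]
      calc l t * ‖w t‖ ≤ 1 * ‖w t‖ := by gcongr; exact (hl01 t).2
        _ = ‖w t‖ := one_mul _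
        _ ≤ ‖w‖ := w.norm_coe_le_norm t
        _ < ε := by simpa [B] using hw
    · rw [image_eq_zero_of_notMem_tsupport hlt, zero_smul, add_zero]
      exact hφV (hj t ht)
  classical
  let G : B × T → M := fun p =>
    if p.2 ∈ U then ψ (φ (h p.2 j) + l p.2 • p.1.1 p.2) else h p.2 j
  have hG_of_zero : ∀ p : B × T, l p.2 • p.1.1 p.2 = 0 → G p = h p.2 j := by
    intro p hp
    by_cases hpU : p.2 ∈ U
    · simp only [G, if_pos hpU, hp, add_zero]
      exact hleft (hj _ hpU)
    · simp only [G, if_neg hpU]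
  have hGc : Continuous G := by
    refine continuous_iff_continuousAt.2 fun p => ?_
    by_cases hpU : p.2 ∈ U
    · have hev : ∀ᶠ p' : B × T in 𝓝 p,
          ψ (φ (h p'.2 j) + l p'.2 • p'.1.1 p'.2) = G p' := by
        filter_upwards [continuous_snd.continuousAt.eventually (hU.mem_nhds hpU)] with p' hp'
        exact (if_pos hp').symm
      refine ContinuousAt.congr ?_ hev
      refine ContinuousAt.comp (g := ψ)
        (hψ.continuousAt (hV.mem_nhds (hmemV _ p.1.2 _ hpU))) ?_
      refine ContinuousAt.add ?_ ?_
      · exact ContinuousAt.comp (f := Prod.snd) (g := fun t => φ (h t j))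
          (hφj.continuousAt (hU.mem_nhds hpU)) continuous_snd.continuousAt
      · exact Continuous.continuousAt (by fun_prop)
    · have hpl : p.2 ∉ tsupport l := fun hp => hpU (hlU hp)
      have hev : ∀ᶠ p' : B × T in 𝓝 p, h p'.2 j = G p' := by
        filter_upwards [continuous_snd.continuousAt.eventually
          ((isClosed_tsupport l).isOpen_compl.mem_nhds hpl)] with p' hp'
        rw [hG_of_zero]
        rw [image_eq_zero_of_notMem_tsupport hp', zero_smul]
      exact ContinuousAt.congr (hcj.comp continuous_snd).continuousAt hev
  let H : C(B × T, ι → M) := ⟨fun p => update (h p.2) j (G p), (h.continuous.comp continuous_snd).update j hGc⟩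
  have hH_of_zero : ∀ p : B × T, l p.2 • p.1.1 p.2 = 0 → H p = h p.2 := fun p hp => by
    simp only [H, ContinuousMap.coe_mk, hG_of_zero p hp, update_eq_self]
  let b₀ : B := ⟨0, Metric.mem_ball_self hε⟩
  have hH0 : H.curry b₀ = h := by
    ext1 t
    exact hH_of_zero (b₀, t) (by simp [b₀])
  have hnhds : H.curry ⁻¹' N ∈ 𝓝 b₀ :=
    H.curry.continuous.continuousAt.preimage_mem_nhds (by rwa [hH0])
  obtain ⟨δ, hδ, hδN⟩ := Metric.mem_nhds_iff.1 hnhds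
  obtain ⟨w, hw, hw0, hwL⟩ := exists_small_add_ne_zero he hE hL
    (g := fun t => φ (h t j) - φ (h t i)) ((hφj.sub hφi).mono hLU) (lt_min hε hδ)
  have hwB : w ∈ B := by simpa [B] using hw.trans_le (min_le_left _ _)
  have hsw : ∀ s : unitInterval, (s : ℝ) • w ∈ B := fun s => by
    have h1 : ‖(s : ℝ) • w‖ ≤ ‖w‖ := by
      rw [norm_smul, Real.norm_of_nonneg s.2.1]
      exact mul_le_of_le_one_left (norm_nonneg _) s.2.2
    simpa [B] using h1.trans_lt (hw.trans_le (min_le_left _ _))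
  refine ⟨H.curry ⟨w, hwB⟩, hδN ?_, ⟨⟨⟨⟨fun p => H (⟨(p.1 : ℝ) • w, hsw p.1⟩, p.2), ?_⟩,
    fun t => ?_, fun t => ?_⟩, fun s t ht => ?_⟩⟩, fun t ht heq => ?_⟩
  · simpa [Subtype.dist_eq, b₀] using hw.trans_le (min_le_right _ _)
  · fun_prop
  · exact hH_of_zero _ (by simp)
  · simp
  · refine hH_of_zero _ ?_
    rw [image_eq_zero_of_notMem_tsupport (f := l) fun h' => ht (hlU h'), zero_smul]
  · have hlt : l t = 1 := hlL ht
    simp only [ContinuousMap.curry_apply, H, ContinuousMap.coe_mk, update_of_ne hij,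
      update_self, G, if_pos (hLU ht), hlt, one_smul] at heq
    have hmem := hmemV w hwB t (hLU ht)
    rw [hlt, one_smul] at hmem
    refine hwL t ht ?_
    have h1 := hright _ hmem (by
      rw [PiLp.add_apply]
      exact add_nonneg (hφ0 _) (hw0 t))
    rw [← heq] at h1
    rw [sub_add_eq_add_sub, ← h1, sub_self]

open Set Function Module in
/-- Density: among the maps `T → M^k` homotopic to a given one relative to a closed set `A` on which
the coordinates `i` and `j` differ, those whose coordinates `i` and `j` differ everywhere are dense,
provided that the dimension of the compact space `T` is less than `dim M`. -/
theorem exists_homotopicRel_ne {n : ℕ} [NeZero n] {M T E ι : Type*} [TopologicalSpace M]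
    [T2Space M] [ChartedSpace (EuclideanHalfSpace n) M] [DecidableEq ι]
    [TopologicalSpace T] [CompactSpace T] [T2Space T] [NormedAddCommGroup E] [NormedSpace ℝ E]
    [FiniteDimensional ℝ E] {e : T → E} (he : Topology.IsClosedEmbedding e) (hE : finrank ℝ E < n)
    {A : Set T} (hA : IsClosed A) (h : C(T, ι → M)) {i j : ι} (hij : i ≠ j)
    (hAh : ∀ t ∈ A, h t i ≠ h t j) {N : Set C(T, ι → M)} (hN : N ∈ 𝓝 h) :
    ∃ h' ∈ N, h.HomotopicRel h' A ∧ ∀ t, h' t i ≠ h' t j := by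
  have hne : IsOpen {y : ι → M | y i ≠ y j} :=
    isOpen_ne_fun (continuous_apply i) (continuous_apply j)
  have key : ∃ W : Set C(T, ι → M), IsOpen W ∧ h ∈ W ∧ ∃ K : Set T, IsCompact K ∧ univ ⊆ K ∧
      ∀ h' ∈ W, h.HomotopicRel h' A → ∀ N' ∈ 𝓝 h', ∃ h'' ∈ N', h'.HomotopicRel h'' A ∧
        ∀ t ∈ K, h'' t i ≠ h'' t j := by
    refine isCompact_univ.induction_on (p := fun s => ∃ W : Set C(T, ι → M), IsOpen W ∧ h ∈ W ∧
      ∃ K : Set T, IsCompact K ∧ s ⊆ K ∧ ∀ h' ∈ W, h.HomotopicRel h' A → ∀ N' ∈ 𝓝 h',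
        ∃ h'' ∈ N', h'.HomotopicRel h'' A ∧ ∀ t ∈ K, h'' t i ≠ h'' t j) ?_ ?_ ?_ ?_
    · exact ⟨univ, isOpen_univ, mem_univ _, ∅, isCompact_empty, Subset.rfl,
        fun h' _ _ N' hN' => ⟨h', mem_of_mem_nhds hN', .refl _, by simp⟩⟩
    · rintro s t hst ⟨W, hW, hhW, K, hK, hsK, H⟩
      exact ⟨W, hW, hhW, K, hK, hst.trans hsK, H⟩
    · rintro s t ⟨W₁, hW₁, hhW₁, K₁, hK₁, hsK₁, H₁⟩ ⟨W₂, hW₂, hhW₂, K₂, hK₂, hsK₂, H₂⟩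
      refine ⟨W₁ ∩ W₂, hW₁.inter hW₂, ⟨hhW₁, hhW₂⟩, K₁ ∪ K₂, hK₁.union hK₂,
        union_subset_union hsK₁ hsK₂, fun h' hh' hr N' hN' => ?_⟩
      obtain ⟨N₀, hN₀N', hN₀, hh'N₀⟩ := mem_nhds_iff.1 hN'
      obtain ⟨h₁, hh₁, hr₁, hK₁h⟩ := H₁ h' hh'.1 hr (N₀ ∩ W₂)
        ((hN₀.inter hW₂).mem_nhds ⟨hh'N₀, hh'.2⟩)
      obtain ⟨h₂, hh₂, hr₂, hK₂h⟩ := H₂ h₁ hh₁.2 (hr.trans hr₁)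
        (N₀ ∩ {f : C(T, ι → M) | MapsTo f K₁ {y | y i ≠ y j}})
        ((hN₀.inter (ContinuousMap.isOpen_setOfPred_mapsTo hK₁ hne)).mem_nhds ⟨hh₁.1, hK₁h⟩)
      exact ⟨h₂, hN₀N' hh₂.1, hr₁.trans hr₂, fun t ht => ht.elim (fun h => hh₂.2 h) (hK₂h t)⟩
    · intro t₀ _
      simp only [nhdsWithin_univ]
      by_cases ht₀ : h t₀ i = h t₀ j
      · set S := (chartAt (EuclideanHalfSpace n) (h t₀ i)).source
        have hS : IsOpen {y : ι → M | y i ∈ S ∧ y j ∈ S} :=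
          ((chartAt _ _).open_source.preimage (continuous_apply i)).inter
            ((chartAt _ _).open_source.preimage (continuous_apply j))
        have hnh : h ⁻¹' {y : ι → M | y i ∈ S ∧ y j ∈ S} ∩ Aᶜ ∈ 𝓝 t₀ := by
          refine ((hS.preimage h.continuous).inter hA.isOpen_compl).mem_nhds ⟨⟨?_, ?_⟩, ?_⟩
          · exact mem_chart_source _ _
          · rw [← ht₀]
            exact mem_chart_source _ _
          · exact fun hmem => hAh _ hmem ht₀
        obtain ⟨K, hKn, hKsub, hK⟩ := local_compact_nhds hnh
        obtain ⟨L, hLn, hLsub, hL⟩ := local_compact_nhds (interior_mem_nhds.2 hKn)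
        refine ⟨L, hLn, _, ContinuousMap.isOpen_setOfPred_mapsTo hK hS,
          fun t ht => (hKsub ht).1, L, hL, Subset.rfl, fun h' hh' _ N' hN' => ?_⟩
        obtain ⟨h'', hh'', hr, hne'⟩ := exists_homotopicRel_ne_of_chart he hE hL.isClosed
          isOpen_interior hLsub h' hij (h t₀ i) (fun t ht => (hh' (interior_subset ht)).1)
          (fun t ht => (hh' (interior_subset ht)).2) hN'
        refine ⟨h'', hh'', ?_, hne'⟩
        obtain ⟨F⟩ := hr
        exact ⟨⟨F.1, fun s t ht => F.2 s t fun htK => (hKsub (interior_subset htK)).2 ht⟩⟩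
      · obtain ⟨K, hKn, hKsub, hK⟩ :=
          local_compact_nhds ((hne.preimage h.continuous).mem_nhds ht₀)
        exact ⟨K, hKn, _, ContinuousMap.isOpen_setOfPred_mapsTo hK hne, hKsub, K, hK, Subset.rfl,
          fun h' hh' _ N' hN' => ⟨h', mem_of_mem_nhds hN', .refl _, hh'⟩⟩
  obtain ⟨W, -, hhW, K, -, hK, H⟩ := key
  obtain ⟨h', hh', hr, hne'⟩ := H h hhW (.refl _) N hN
  exact ⟨h', hh', hr, fun t => hne' t (hK (mem_univ t))⟩

open Set Function Module in
/-- The pair `(M^k, F(M,k))` is `(dim M - 1)`-connected: a map `T → M^k` from a compact space of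
dimension less than `dim M` that sends a closed subset `A` to the configuration space can be
compressed into the configuration space relative to `A`. -/
theorem exists_homotopicRel_injective {n : ℕ} [NeZero n] {M T E ι : Type*} [TopologicalSpace M]
    [T2Space M] [ChartedSpace (EuclideanHalfSpace n) M] [Finite ι]
    [TopologicalSpace T] [CompactSpace T] [T2Space T] [NormedAddCommGroup E] [NormedSpace ℝ E]
    [FiniteDimensional ℝ E] {e : T → E} (he : Topology.IsClosedEmbedding e) (hE : finrank ℝ E < n)
    {A : Set T} (hA : IsClosed A) (h : C(T, ι → M)) (hAh : ∀ t ∈ A, Injective (h t)) :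
    ∃ h' : C(T, ι → M), h.HomotopicRel h' A ∧ ∀ t, Injective (h' t) := by
  classical
  have := Fintype.ofFinite ι
  have key : ∀ P : Finset (ι × ι), ∃ h' : C(T, ι → M), h.HomotopicRel h' A ∧
      ∀ p ∈ P, p.1 ≠ p.2 → ∀ t, h' t p.1 ≠ h' t p.2 := by
    intro P
    induction P using Finset.induction_on with
    | empty => exact ⟨h, .refl _, by simp⟩
    | insert p P hp ih =>
      obtain ⟨h₁, hr₁, hP⟩ := ih
      by_cases hpp : p.1 = p.2
      · refine ⟨h₁, hr₁, fun p' hp' => ?_⟩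
        rcases Finset.mem_insert.1 hp' with rfl | hp'
        · exact fun hne => absurd hpp hne
        · exact hP p' hp'
      · have hopen : IsOpen (⋂ p' ∈ P, {f : C(T, ι → M) |
            MapsTo f univ {y | p'.1 ≠ p'.2 → y p'.1 ≠ y p'.2}}) := by
          refine isOpen_biInter_finset fun p' _ =>
            ContinuousMap.isOpen_setOfPred_mapsTo isCompact_univ ?_
          by_cases hp' : p'.1 = p'.2
          · simp [hp']
          · simpa [hp'] using isOpen_ne_fun (continuous_apply p'.1) (continuous_apply p'.2)
        obtain ⟨h₂, hmem, hr₂, hne⟩ := exists_homotopicRel_ne he hE hA h₁ hpp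
          (fun t ht heq => hpp (hAh t ht (by rw [hr₁.fst_eq_snd ht, heq])))
          (hopen.mem_nhds (mem_iInter₂.2 fun p' hp' t _ hne => hP p' hp' hne t))
        refine ⟨h₂, hr₁.trans hr₂, fun p' hp' => ?_⟩
        rcases Finset.mem_insert.1 hp' with rfl | hp'
        · exact fun _ => hne
        · exact fun hne' t => mem_iInter₂.1 hmem p' hp' (mem_univ t) hne'
  obtain ⟨h', hr, hne⟩ := key Finset.univ
  exact ⟨h', hr, fun t i j hij => by_contra fun hne' => hne (i, j) (Finset.mem_univ _) hne' t hij⟩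

/-- The boundary of a finite-dimensional cube is closed. -/
theorem Cube.isClosed_boundary (N : Type*) [Finite N] : IsClosed (Cube.boundary N) := by
  have : Cube.boundary N = ⋃ i : N, {y | y i = 0 ∨ y i = 1} := by
    ext y
    simp [Cube.boundary]
  rw [this]
  exact isClosed_iUnion_of_finite fun i =>
    (isClosed_eq (continuous_apply i) continuous_const).union
      (isClosed_eq (continuous_apply i) continuous_const)

/-- The inclusion of the unit cube into Euclidean space is a closed embedding. -/
theorem Cube.isClosedEmbedding_coe (N : Type*) :
    Topology.IsClosedEmbedding fun (y : N → unitInterval) (i : N) => (y i : ℝ) :=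
  Continuous.isClosedEmbedding
    (continuous_pi fun i => continuous_subtype_val.comp (continuous_apply i)) fun _ _ h => funext fun i => Subtype.ext (congrFun h i)

/-- The inclusion `F(M,k) → M^k` is surjective on `π_q` for `q < dim M`. -/
theorem HomotopyGroup.induced_confToPi_surjective {n : ℕ} [NeZero n] {M : Type*}
    [TopologicalSpace M] [T2Space M] [ChartedSpace (EuclideanHalfSpace n) M] {k q : ℕ}
    (hq : q < n) (x : Conf M k) :
    Function.Surjective (HomotopyGroup.induced (N := Fin q) (confToPi M k) x) := by
  intro a
  induction a using Quotient.inductionOn with | _ p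
  obtain ⟨p', hr, hp'⟩ := exists_homotopicRel_injective (n := n)
    (Cube.isClosedEmbedding_coe (Fin q)) (by simpa using hq) (Cube.isClosed_boundary (Fin q)) p.1
    (fun t ht => by rw [p.2 t ht]; exact x.2)
  refine ⟨Quotient.mk _ ⟨⟨fun t => ⟨p' t, hp' t⟩, by fun_prop⟩, fun t ht => ?_⟩,
    Quotient.sound hr.symm⟩
  exact Subtype.ext ((hr.fst_eq_snd ht).symm.trans (p.2 t ht))

/-- The inclusion `F(M,k) → M^k` is injective on `π_q` for `q + 1 < dim M`. -/
theorem HomotopyGroup.induced_confToPi_injective {n : ℕ} [NeZero n] {M : Type*}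
    [TopologicalSpace M] [T2Space M] [ChartedSpace (EuclideanHalfSpace n) M] {k q : ℕ}
    (hq : q + 1 < n) (x : Conf M k) :
    Function.Injective (HomotopyGroup.induced (N := Fin q) (confToPi M k) x) := by
  intro a b hab
  induction a using Quotient.inductionOn with | _ p
  induction b using Quotient.inductionOn with | _ p'
  obtain ⟨F⟩ : (GenLoop.induced (confToPi M k) p).1.HomotopicRel
    (GenLoop.induced (confToPi M k) p').1 (Cube.boundary (Fin q)) := Quotient.exact hab
  let A : Set (unitInterval × (Fin q → unitInterval)) :=
    {y | y.1 = 0 ∨ y.1 = 1 ∨ y.2 ∈ Cube.boundary (Fin q)}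
  have hA : IsClosed A :=
    (isClosed_eq continuous_fst continuous_const).union
      ((isClosed_eq continuous_fst continuous_const).union
        ((Cube.isClosed_boundary _).preimage continuous_snd))
  have hF0 : ∀ t, F (0, t) = (p t).1 := fun t => F.apply_zero t
  have hF1 : ∀ t, F (1, t) = (p' t).1 := fun t => F.apply_one t
  have hFb : ∀ s, ∀ t ∈ Cube.boundary (Fin q), F (s, t) = (p t).1 := fun s t ht => F.2 s t ht
  obtain ⟨G, hr, hG⟩ := exists_homotopicRel_injective (n := n)
    (e := Prod.map Subtype.val fun (y : Fin q → unitInterval) (i : Fin q) => (y i : ℝ))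
    (Continuous.isClosedEmbedding
      (continuous_subtype_val.prodMap (Cube.isClosedEmbedding_coe (Fin q)).continuous)
      (Subtype.val_injective.prodMap (Cube.isClosedEmbedding_coe (Fin q)).injective))
    (by simpa [add_comm] using hq) hA F.toContinuousMap (by
      rintro ⟨s, t⟩ (rfl | rfl | ht)
      · exact (hF0 t).symm ▸ (p t).2
      · exact (hF1 t).symm ▸ (p' t).2
      · exact (hFb s t ht).symm ▸ (p t).2)
  refine Quotient.sound ⟨⟨⟨⟨fun y => ⟨G y, hG y⟩, by fun_prop⟩, fun t => ?_, fun t => ?_⟩,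
    fun s t ht => ?_⟩⟩
  · exact Subtype.ext ((hr.fst_eq_snd (Or.inl rfl)).symm.trans (hF0 t))
  · exact Subtype.ext ((hr.fst_eq_snd (Or.inr (Or.inl rfl))).symm.trans (hF1 t))
  · exact Subtype.ext ((hr.fst_eq_snd (Or.inr (Or.inr ht))).symm.trans (hFb s t ht))

/-- The inclusion `i_k(M) : F(M,k) → M^k` is `(dim M − 1)`-connected: for any
basepoint, `π_q` is surjective for `q = n − 1` and bijective for `q ≤ n − 2`. -/
theorem stmt7 (n : ℕ) [NeZero n] (M : Type) [TopologicalSpace M] [T2Space M]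
    [SecondCountableTopology M] [CompactSpace M] [ConnectedSpace M]
    [ChartedSpace (EuclideanHalfSpace n) M]
    (hbd : ((mfdInterior n M)ᶜ : Set M).Nonempty)
    (k : ℕ) (hk : 1 ≤ k) :
    ∀ x : Conf M k,
      Function.Surjective
        (HomotopyGroup.induced (N := Fin (n - 1)) (confToPi M k) x) ∧
      ∀ q : ℕ, q + 2 ≤ n →
        Function.Bijective
          (HomotopyGroup.induced (N := Fin q) (confToPi M k) x) := by
  have hn : 0 < n := Nat.pos_of_ne_zero (NeZero.ne n)
  exact fun x => ⟨HomotopyGroup.induced_confToPi_surjective (n := n) (by omega) x, fun q hq =>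
    ⟨HomotopyGroup.induced_confToPi_injective (n := n) (by omega) x,
      HomotopyGroup.induced_confToPi_surjective (n := n) (by omega) x⟩⟩
end
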